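/- arXiv:2501.00429 — 6 statements merged into one kernel-verified Lean document; each statement's English description precedes it below -/
import Mathlib

section
/- Let V : ℝ^d → ℝ be C² with Z_ε = ∫ exp(−V/ε) dx < ∞, and let L f = −∇V·∇f + ε·Δf be the generator of the Langevin dynamics. Suppose W : ℝ^d → [1, ∞) is C² and there exist a measurable set U ⊆ ℝ^d and constants b, σ > 0 such that ε^{-1}·(L W)(x) ≤ −σ·W(x) + b·1_U(x) for all x ∈ ℝ^d. If the truncated Gibbs measure μ_{ε,U} satisfies the Poincaré inequality PI(ρ_{ε,U}) with ρ_{ε,U} > 0, then the Gibbs measure μ_ε satisfies the Poincaré inequality with constant at least σ·ρ_{ε,U}/(b + ρ_{ε,U}). -/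
open MeasureTheory Real Filter Metric Set
open scoped RealInnerProductSpace ENNReal Topology

noncomputable section

abbrev Euc (n : ℕ) := EuclideanSpace ℝ (Fin n)

variable {d : ℕ}

def localMinSet (V : Euc d → ℝ) : Set (Euc d) := {x | IsLocalMin V x}

def localMaxSet (V : Euc d → ℝ) : Set (Euc d) := {x | IsLocalMax V x}

def hessQ (V : Euc d → ℝ) (x v : Euc d) : ℝ := ⟪fderiv ℝ (gradient V) x v, v⟫

def lap (V : Euc d → ℝ) (x : Euc d) : ℝ :=
  ∑ i, hessQ V x (EuclideanSpace.basisFun (Fin d) ℝ i)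

def PoincareIneq {d : ℕ} (μ : Measure (Euc d)) (ρ : ℝ) : Prop :=
  ∀ f : Euc d → ℝ, ContDiff ℝ 1 f →
    Integrable (fun x => (f x) ^ 2) μ →
    Integrable (fun x => ‖gradient f x‖ ^ 2) μ →
    ∫ x, (f x - ∫ y, f y ∂μ) ^ 2 ∂μ ≤ (1 / ρ) * ∫ x, ‖gradient f x‖ ^ 2 ∂μ

def gibbs (V : Euc d → ℝ) (ε : ℝ) : Measure (Euc d) :=
  (ENNReal.ofReal (∫ x, exp (-V x / ε)))⁻¹ •
    volume.withDensity fun x => ENNReal.ofReal (exp (-V x / ε))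

def gibbsOn (V : Euc d → ℝ) (ε : ℝ) (U : Set (Euc d)) : Measure (Euc d) :=
  (ENNReal.ofReal (∫ x in U, exp (-V x / ε)))⁻¹ •
    (volume.restrict U).withDensity fun x => ENNReal.ofReal (exp (-V x / ε))

def uniformOn {d : ℕ} (U : Set (Euc d)) : Measure (Euc d) :=
  (volume U)⁻¹ • volume.restrict U

def Assumption1 (V : Euc d → ℝ) (ν : ℝ) (𝒩 : Set (Euc d) → Set (Euc d)) : Prop :=
  0 < ν ∧ ∀ x ∈ localMinSet V,
    IsOpen (𝒩 (connectedComponentIn (localMinSet V) x)) ∧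
    connectedComponentIn (localMinSet V) x ⊆ 𝒩 (connectedComponentIn (localMinSet V) x) ∧
    ContDiffOn ℝ 3 V (𝒩 (connectedComponentIn (localMinSet V) x)) ∧
    ∀ y ∈ 𝒩 (connectedComponentIn (localMinSet V) x),
      ν * (V y - sInf (V '' 𝒩 (connectedComponentIn (localMinSet V) x))) ≤ ‖gradient V y‖ ^ 2

def NSet (V : Euc d → ℝ) (𝒩 : Set (Euc d) → Set (Euc d)) : Set (Euc d) :=
  ⋃ x ∈ localMinSet V, 𝒩 (connectedComponentIn (localMinSet V) x)

def Assumption2 (V : Euc d → ℝ) (𝒩 : Set (Euc d) → Set (Euc d)) : Prop :=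
  ∀ x ∉ NSet V 𝒩, gradient V x = 0 → ∀ v : Euc d, v ≠ 0 → hessQ V x v < 0

def Assumption3 (V : Euc d → ℝ) (R₀ ν_eb C_g : ℝ) : Prop :=
  0 < R₀ ∧ 0 < ν_eb ∧ 0 < C_g ∧
  (∀ x : Euc d, R₀ ≤ ‖x‖ →
      ν_eb * infDist x (localMinSet V) ≤ ‖gradient V x‖ ∧ |lap V x| ≤ C_g * ‖x‖ ^ 2) ∧
  Tendsto V (cocompact (Euc d)) atTop ∧
  localMinSet V ⊆ closedBall 0 R₀


def dens (V : Euc d → ℝ) (ε : ℝ) : Measure (Euc d) :=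
  volume.withDensity fun x => ENNReal.ofReal (exp (-V x / ε))

lemma aux_grad_inner {f : Euc d → ℝ} (x v : Euc d) (_hf : DifferentiableAt ℝ f x) :
    ⟪gradient f x, v⟫ = fderiv ℝ f x v := by
  simp [gradient]

lemma aux_grad_contDiff {f : Euc d → ℝ} {n m : WithTop ℕ∞} (hf : ContDiff ℝ n f) (h : m + 1 ≤ n) :
    ContDiff ℝ m (gradient f) := by
  have : ContDiff ℝ m (fderiv ℝ f) := hf.fderiv_right h
  exact (InnerProductSpace.toDual ℝ (Euc d)).symm.contDiff.comp this

lemma aux_int (V : Euc d → ℝ) (ε : ℝ) (hV : Continuous V) (f : Euc d → ℝ) :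
    ∫ x, f x ∂(dens V ε) = ∫ x, f x * exp (-V x / ε) := by
  unfold dens
  rw [integral_withDensity_eq_integral_toReal_smul (by fun_prop) (by simp)]
  congr 1; ext x
  rw [ENNReal.toReal_ofReal (exp_pos _).le, smul_eq_mul, mul_comm]

lemma aux_fin (V : Euc d → ℝ) (ε : ℝ) (hZ : Integrable (fun x => exp (-V x / ε))) :
    IsFiniteMeasure (dens V ε) := isFiniteMeasure_withDensity_ofReal hZ.2

lemma aux_ibp (V W φ : Euc d → ℝ) (ε : ℝ) (hV : ContDiff ℝ 2 V) (hε : 0 < ε)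
    (hW : ContDiff ℝ 2 W) (hφ : ContDiff ℝ 1 φ) (hc : HasCompactSupport φ) :
    ∫ x, φ x * (ε⁻¹ * (-⟪gradient V x, gradient W x⟫ + ε * lap W x)) ∂(dens V ε)
      = - ∫ x, ⟪gradient φ x, gradient W x⟫ ∂(dens V ε) := by
  rw [aux_int V ε hV.continuous, aux_int V ε hV.continuous]
  have hgW : ContDiff ℝ 1 (gradient W) := aux_grad_contDiff hW (by norm_num)
  have hgV : ContDiff ℝ 1 (gradient V) := aux_grad_contDiff hV (by norm_num)
  have hVd : Differentiable ℝ V := hV.differentiable (by norm_num)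
  have hφd : Differentiable ℝ φ := hφ.differentiable (by norm_num)
  let e := EuclideanSpace.basisFun (Fin d) ℝ
  let g : Fin d → Euc d → ℝ := fun i x => exp (-V x / ε) * ⟪gradient W x, e i⟫
  have hg : ∀ i, ContDiff ℝ 1 (g i) := by
    intro i
    have h1 : ContDiff ℝ 1 V := hV.of_le (by norm_num)
    exact ((h1.neg.div_const ε).exp).mul (hgW.inner ℝ contDiff_const)
  have hg' : ∀ i x, fderiv ℝ (g i) x (e i) = exp (-V x / ε) *
      (ε⁻¹ * (-(⟪gradient V x, e i⟫ * ⟪e i, gradient W x⟫)) + hessQ W x (e i)) := by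
    intro i x
    have h1 : HasFDerivAt (fun x => exp (-V x / ε)) (exp (-V x / ε) • (ε⁻¹ • (-(fderiv ℝ V x)))) x := by
      have := ((hVd x).hasFDerivAt.neg.const_mul ε⁻¹).exp
      simpa [div_eq_inv_mul] using this
    have h2 : HasFDerivAt (fun x => ⟪gradient W x, e i⟫) _ x :=
      ((hgW.differentiable (by norm_num) x).hasFDerivAt).inner ℝ (hasFDerivAt_const (e i) x)
    have h3 := (h1.mul h2).fderiv
    change fderiv ℝ (fun x => exp (-V x / ε) * ⟪gradient W x, e i⟫) x (e i) = _
    have h4 : fderiv ℝ (fun x => exp (-V x / ε) * ⟪gradient W x, e i⟫) x = _ := h3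
    rw [h4, aux_grad_inner x (e i) (hVd x), real_inner_comm (gradient W x) (e i)]
    simp [hessQ, fderivInnerCLM_apply]
    ring
  have hcont : ∀ i, Continuous fun x => fderiv ℝ (g i) x (e i) := fun i =>
    ((hg i).continuous_fderiv (by norm_num)).clm_apply continuous_const
  have hcontφ : ∀ i, Continuous fun x => fderiv ℝ φ x (e i) := fun i =>
    (hφ.continuous_fderiv (by norm_num)).clm_apply continuous_const
  have hcφ : ∀ i, HasCompactSupport fun x => fderiv ℝ φ x (e i) := fun i =>
    hc.fderiv_apply ℝ (e i)
  have i1 : ∀ i, Integrable (fun x => φ x * fderiv ℝ (g i) x (e i)) := fun i =>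
    (hφ.continuous.mul (hcont i)).integrable_of_hasCompactSupport hc.mul_right
  have i2 : ∀ i, Integrable (fun x => fderiv ℝ φ x (e i) * g i x) := fun i =>
    ((hcontφ i).mul (hg i).continuous).integrable_of_hasCompactSupport (hcφ i).mul_right
  have i3 : ∀ i, Integrable (fun x => φ x * g i x) := fun i =>
    (hφ.continuous.mul (hg i).continuous).integrable_of_hasCompactSupport hc.mul_right
  have key : ∀ i, ∫ x, φ x * fderiv ℝ (g i) x (e i) = - ∫ x, fderiv ℝ φ x (e i) * g i x :=
    fun i => integral_mul_fderiv_eq_neg_fderiv_mul_of_integrable (i2 i) (i1 i) (i3 i) (fun x _ => hφd x)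
      (fun x _ => (hg i).differentiable (by norm_num) x)
  have L : ∀ x, φ x * (ε⁻¹ * (-⟪gradient V x, gradient W x⟫ + ε * lap W x)) * exp (-V x / ε)
      = ∑ i, φ x * fderiv ℝ (g i) x (e i) := by
    intro x
    rw [← Finset.mul_sum]
    simp_rw [hg']
    rw [← Finset.mul_sum, Finset.sum_add_distrib, ← Finset.mul_sum, Finset.sum_neg_distrib,
      e.sum_inner_mul_inner]
    change _ = φ x * (exp (-V x / ε) * (ε⁻¹ * -⟪gradient V x, gradient W x⟫ + lap W x))
    field_simp
  have R : ∀ x, ⟪gradient φ x, gradient W x⟫ * exp (-V x / ε)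
      = ∑ i, fderiv ℝ φ x (e i) * g i x := by
    intro x
    rw [← e.sum_inner_mul_inner, Finset.sum_mul]
    refine Finset.sum_congr rfl fun i _ => ?_
    rw [aux_grad_inner x (e i) (hφd x), real_inner_comm (gradient W x) (e i)]
    simp only [g]; ring
  simp_rw [L, R]
  rw [integral_finsetSum _ fun i _ => i1 i, integral_finsetSum _ fun i _ => i2 i,
    ← Finset.sum_neg_distrib]
  exact Finset.sum_congr rfl fun i _ => key i

lemma aux_grad_compact {h : Euc d → ℝ} (hc : HasCompactSupport h) :
    HasCompactSupport (gradient h) :=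
  (hc.fderiv ℝ).comp_left (g := (InnerProductSpace.toDual ℝ (Euc d)).symm) (map_zero _)

lemma aux_cc (V : Euc d → ℝ) (ε : ℝ) (hZ : Integrable (fun x => exp (-V x / ε)))
    {f : Euc d → ℝ} (hf : Continuous f) (hc : HasCompactSupport f) : Integrable f (dens V ε) := by
  have := aux_fin V ε hZ
  exact hf.integrable_of_hasCompactSupport hc

lemma aux_pt (h W : Euc d → ℝ) (x : Euc d) (hhx : DifferentiableAt ℝ h x)
    (hWx : DifferentiableAt ℝ W x) (hW0 : W x ≠ 0) :
    ⟪gradient (fun x => h x ^ 2 / W x) x, gradient W x⟫ ≤ ‖gradient h x‖ ^ 2 := by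
    have hd := hhx.hasFDerivAt
    have hw := hWx.hasFDerivAt
    have h1 := HasFDerivAt.fderiv ((hd.pow 2).mul ((hasDerivAt_inv hW0).comp_hasFDerivAt x hw))
    have h2 : fderiv ℝ (fun x => h x ^ 2 / W x) x = fderiv ℝ ((fun x => h x ^ 2) * (fun y => y⁻¹) ∘ W) x := rfl
    rw [inner_gradient_left, h2, h1]
    have e1 : fderiv ℝ W x (gradient W x) = ‖gradient W x‖ ^ 2 := by
      rw [← aux_grad_inner _ _ hw.differentiableAt, real_inner_self_eq_norm_sq]
    have e2 : fderiv ℝ h x (gradient W x) = ⟪gradient h x, gradient W x⟫ := by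
      rw [← aux_grad_inner _ _ hd.differentiableAt]
    simp [e1, e2, -inner_gradient_left, -inner_gradient_right]
    have := norm_sub_sq_real (gradient h x) ((h x / W x) • gradient W x)
    rw [inner_smul_right, norm_smul, mul_pow, Real.norm_eq_abs, sq_abs] at this
    have h0 := sq_nonneg ‖gradient h x - (h x / W x) • gradient W x‖
    rw [this] at h0
    have e3 : (h x / W x) ^ 2 = h x ^ 2 * (W x ^ 2)⁻¹ := by rw [div_pow, div_eq_mul_inv]
    rw [e3, div_eq_mul_inv] at h0
    nlinarith

set_option maxHeartbeats 400000 in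
lemma aux_cpt (V W h : Euc d → ℝ) (ε b σ : ℝ) (U : Set (Euc d))
    (hV : ContDiff ℝ 2 V) (hε : 0 < ε)
    (hZ : Integrable (fun x => exp (-V x / ε)))
    (hW : ContDiff ℝ 2 W) (hW1 : ∀ x, 1 ≤ W x)
    (hU : MeasurableSet U) (hb : 0 < b)
    (hLyap : ∀ x : Euc d,
      ε⁻¹ * (-⟪gradient V x, gradient W x⟫ + ε * lap W x)
        ≤ -σ * W x + b * U.indicator (fun _ => (1 : ℝ)) x)
    (hh : ContDiff ℝ 1 h) (hc : HasCompactSupport h) :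
    σ * ∫ x, h x ^ 2 ∂(dens V ε) ≤
      ∫ x, ‖gradient h x‖ ^ 2 ∂(dens V ε) + b * ∫ x in U, h x ^ 2 ∂(dens V ε) := by
  have := aux_fin V ε hZ
  have hgW : ContDiff ℝ 1 (gradient W) := aux_grad_contDiff hW (by norm_num)
  have hgV : ContDiff ℝ 1 (gradient V) := aux_grad_contDiff hV (by norm_num)
  have hgh : Continuous (gradient h) :=
    (aux_grad_contDiff (m := 0) hh (by norm_num)).continuous
  have hW0 : ∀ x, W x ≠ 0 := fun x => (by linarith [hW1 x] : (0:ℝ) < W x).ne'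
  have hWd : ContDiff ℝ 1 W := hW.of_le (by norm_num)
  set φ : Euc d → ℝ := fun x => h x ^ 2 / W x with hφdef
  have hφ : ContDiff ℝ 1 φ := (hh.pow 2).div hWd hW0
  have hc2 : HasCompactSupport (fun x => h x ^ 2) := hc.comp_left (g := fun t : ℝ => t ^ 2) (by simp)
  have hcφ : HasCompactSupport φ := by
    have : φ = (fun x => h x ^ 2) * (fun x => (W x)⁻¹) := by
      ext x; simp [hφdef, div_eq_mul_inv]
    rw [this]; exact hc2.mul_right
  have hgφ : ∀ x, ⟪gradient φ x, gradient W x⟫ ≤ ‖gradient h x‖ ^ 2 := by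
    intro x
    exact aux_pt h W x (hh.differentiable (by norm_num) x) (hWd.differentiable (by norm_num) x) (hW0 x)
  have hlap : Continuous (lap W) := by
    have hq : ∀ v : Euc d, Continuous fun x => hessQ W x v := by
      intro v
      have q1 : Continuous fun x => fderiv ℝ (gradient W) x v :=
        (hgW.continuous_fderiv (by norm_num)).clm_apply continuous_const
      exact Continuous.inner q1 continuous_const
    exact continuous_finsetSum _ fun i _ => hq _
  have hLc : Continuous fun x => ε⁻¹ * (-⟪gradient V x, gradient W x⟫ + ε * lap W x) :=
    continuous_const.mul (((hgV.continuous.inner hgW.continuous).neg).add (continuous_const.mul hlap))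
  have i1 : Integrable (fun x => φ x * (ε⁻¹ * (-⟪gradient V x, gradient W x⟫ + ε * lap W x)))
      (dens V ε) := by
    refine aux_cc V ε hZ (hφ.continuous.mul hLc) (hcφ.mono ?_)
    intro x hx hx'
    apply hx
    simp only [hx', zero_mul]
  have i2 : Integrable (fun x => h x ^ 2) (dens V ε) :=
    aux_cc V ε hZ (hh.continuous.pow 2) hc2
  have i3 : Integrable (fun x => ‖gradient h x‖ ^ 2) (dens V ε) := by
    refine aux_cc V ε hZ (hgh.norm.pow 2) ((aux_grad_compact hc).mono ?_)
    intro x hx hx'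
    apply hx
    simp [hx']
  have hcg : Continuous (gradient φ) := 
    (aux_grad_contDiff (m := 0) hφ (by norm_num)).continuous
  have i4 : Integrable (fun x => ⟪gradient φ x, gradient W x⟫) (dens V ε) := by
    have q1 : Continuous (fun x => ⟪gradient φ x, gradient W x⟫) := hcg.inner hgW.continuous
    refine aux_cc V ε hZ q1 ((aux_grad_compact hcφ).mono ?_)
    intro x hx hx'
    apply hx
    simp [hx']
  have hibp := aux_ibp V W φ ε hV hε hW hφ hcφ
  have j2 : Integrable (fun x => b * U.indicator (fun x => h x ^ 2) x) (dens V ε) :=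
    (i2.indicator hU).const_mul b
  have j3 : Integrable (fun x => b * U.indicator (fun x => h x ^ 2) x
        - φ x * (ε⁻¹ * (-⟪gradient V x, gradient W x⟫ + ε * lap W x))) (dens V ε) := j2.sub i1
  have step : ∫ x, σ * h x ^ 2 ∂(dens V ε) ≤
      ∫ x, (b * U.indicator (fun x => h x ^ 2) x
        - φ x * (ε⁻¹ * (-⟪gradient V x, gradient W x⟫ + ε * lap W x))) ∂(dens V ε) := by
    have j1 : Integrable (fun x => σ * h x ^ 2) (dens V ε) := i2.const_mul σ
    refine integral_mono j1 j3 fun x => ?_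
    have hφ0 : 0 ≤ φ x := div_nonneg (sq_nonneg _) (by linarith [hW1 x])
    have h1 := mul_le_mul_of_nonneg_left (hLyap x) hφ0
    have h2 : φ x * W x = h x ^ 2 := div_mul_cancel₀ _ (hW0 x)
    have h3 : φ x * (b * U.indicator (fun _ => (1:ℝ)) x) ≤ b * U.indicator (fun x => h x ^ 2) x := by
      by_cases hx : x ∈ U
      · simp only [indicator_of_mem hx]
        have : φ x ≤ h x ^ 2 := div_le_self (sq_nonneg _) (hW1 x)
        nlinarith
      · simp [indicator_of_notMem hx]
    have h4 : φ x * (-σ * W x) = - (σ * h x ^ 2) := by rw [← h2]; ring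
    simp only
    linarith [mul_add (φ x) (-σ * W x) (b * U.indicator (fun _ => (1:ℝ)) x)]
  rw [integral_sub j2 i1, integral_const_mul, integral_const_mul,
    integral_indicator hU, hibp] at step
  have := integral_mono i4 i3 hgφ
  linarith

set_option maxHeartbeats 400000 in
lemma aux_lim (V g : Euc d → ℝ) (ε b σ : ℝ) (U : Set (Euc d))
    (H : ∀ h : Euc d → ℝ, ContDiff ℝ 1 h → HasCompactSupport h →
      σ * ∫ x, h x ^ 2 ∂(dens V ε) ≤
      ∫ x, ‖gradient h x‖ ^ 2 ∂(dens V ε) + b * ∫ x in U, h x ^ 2 ∂(dens V ε))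
    (hg : ContDiff ℝ 1 g) (i1 : Integrable (fun x => g x ^ 2) (dens V ε))
    (i2 : Integrable (fun x => ‖gradient g x‖ ^ 2) (dens V ε)) :
    σ * ∫ x, g x ^ 2 ∂(dens V ε) ≤
      ∫ x, ‖gradient g x‖ ^ 2 ∂(dens V ε) + b * ∫ x in U, g x ^ 2 ∂(dens V ε) := by
  obtain ⟨χ, hχ1⟩ : ∃ χ : ContDiffBump (0 : Euc d), χ.rIn = 1 :=
    ⟨⟨1, 2, by norm_num, by norm_num⟩, rfl⟩
  have hχ : ContDiff ℝ 1 (χ : Euc d → ℝ) := χ.contDiff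
  have hχc : HasCompactSupport (χ : Euc d → ℝ) := χ.hasCompactSupport
  obtain ⟨C, hC⟩ := (hχc.fderiv ℝ).exists_bound_of_continuous (hχ.continuous_fderiv (by norm_num))
  have hC0 : 0 ≤ C := (norm_nonneg _).trans (hC 0)
  obtain ⟨r, hr0, hr1, hrt⟩ : ∃ r : ℕ → ℝ, (∀ n, 0 < r n) ∧ (∀ n, r n ≤ 1) ∧
      Tendsto r atTop (𝓝 0) := by
    refine ⟨fun n => 1 / ((n : ℝ) + 1), fun n => by positivity, fun n => ?_,
      tendsto_one_div_add_atTop_nhds_zero_nat⟩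
    rw [div_le_one (by positivity)]
    linarith [(n.cast_nonneg : (0:ℝ) ≤ n)]
  let c : ℕ → Euc d → ℝ := fun n x => χ (r n • x)
  let h : ℕ → Euc d → ℝ := fun n x => c n x * g x
  have hcs : ∀ n, ContDiff ℝ 1 (c n) := fun n => hχ.comp (contDiff_const_smul (r n))
  have hhs : ∀ n, ContDiff ℝ 1 (h n) := fun n => (hcs n).mul hg
  have hhc : ∀ n, HasCompactSupport (h n) := fun n =>
    (hχc.comp_smul (hr0 n).ne').mul_right
  have hev : ∀ x, ∀ᶠ n in atTop, h n =ᶠ[𝓝 x] g := by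
    intro x
    have ht : Tendsto (fun n => r n • x) atTop (𝓝 0) := by
      simpa using hrt.smul_const x
    have : ∀ᶠ n in atTop, r n • x ∈ ball (0 : Euc d) 1 :=
      ht.eventually (ball_mem_nhds _ one_pos)
    filter_upwards [this] with n hn
    have hcont : Continuous fun y : Euc d => r n • y := continuous_const_smul _
    have hy' : ∀ᶠ y in 𝓝 x, r n • y ∈ ball (0 : Euc d) 1 :=
      hcont.continuousAt.eventually_mem (isOpen_ball.mem_nhds hn)
    filter_upwards [hy'] with y hy
    have : χ (r n • y) = 1 := χ.one_of_mem_closedBall (by rw [hχ1]; exact ball_subset_closedBall hy)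
    simp [h, c, this]
  have hle : ∀ n x, h n x ^ 2 ≤ g x ^ 2 := by
    intro n x
    have h1 : 0 ≤ c n x := χ.nonneg
    have h2 : c n x ≤ 1 := χ.le_one
    simp only [h, mul_pow]
    exact mul_le_of_le_one_left (sq_nonneg _) (pow_le_one₀ h1 h2)
  have hcf : ∀ n x, ‖fderiv ℝ (c n) x‖ ≤ C := by
    intro n x
    have h1 : HasFDerivAt (c n) _ x :=
      ((hχ.differentiable (by norm_num) (r n • x)).hasFDerivAt).comp x
        ((hasFDerivAt_id x).const_smul (r n))
    rw [h1.fderiv]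
    refine (ContinuousLinearMap.opNorm_comp_le _ _).trans ?_
    have h3 : ‖r n • ContinuousLinearMap.id ℝ (Euc d)‖ ≤ 1 := by
      rw [norm_smul, Real.norm_eq_abs, abs_of_pos (hr0 n)]
      exact mul_le_one₀ (hr1 n) (norm_nonneg _) ContinuousLinearMap.norm_id_le
    calc _ ≤ C * 1 := mul_le_mul (hC _) h3 (norm_nonneg _) hC0
      _ = C := mul_one C
  have hnorm : ∀ (f : Euc d → ℝ) x, ‖gradient f x‖ = ‖fderiv ℝ f x‖ := fun f x => by
    simp [gradient]
  have hgle : ∀ n x, ‖gradient (h n) x‖ ^ 2 ≤ 2 * ‖gradient g x‖ ^ 2 + 2 * C ^ 2 * g x ^ 2 := by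
    intro n x
    rw [hnorm, hnorm]
    have h1 := (((hcs n).differentiable (by norm_num) x).hasFDerivAt.mul
      (hg.differentiable (by norm_num) x).hasFDerivAt).fderiv
    have h1' : fderiv ℝ (h n) x = _ := h1
    have h2 : ‖fderiv ℝ (h n) x‖ ≤ ‖fderiv ℝ g x‖ + C * |g x| := by
      rw [h1']
      refine (norm_add_le _ _).trans ?_
      rw [norm_smul, norm_smul]
      have a1 : ‖c n x‖ ≤ 1 := by
        rw [Real.norm_eq_abs, abs_of_nonneg χ.nonneg]; exact χ.le_one
      have a2 := mul_le_mul_of_nonneg_right a1 (norm_nonneg (fderiv ℝ g x))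
      have a3 := mul_le_mul_of_nonneg_left (hcf n x) (norm_nonneg (g x))
      rw [Real.norm_eq_abs (g x)] at *
      linarith
    have h3 := pow_le_pow_left₀ (norm_nonneg _) h2 2
    have h4 := sq_nonneg (‖fderiv ℝ g x‖ - C * |g x|)
    have h5 : (C * |g x|) ^ 2 = C ^ 2 * g x ^ 2 := by rw [mul_pow, sq_abs]
    nlinarith
  have T1 : ∀ μ : Measure (Euc d), Integrable (fun x => g x ^ 2) μ →
      Tendsto (fun n => ∫ x, h n x ^ 2 ∂μ) atTop (𝓝 (∫ x, g x ^ 2 ∂μ)) := by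
    intro μ hi
    refine tendsto_integral_of_dominated_convergence _ (fun n =>
      ((hhs n).continuous.pow 2).aestronglyMeasurable) hi (fun n => ae_of_all _ fun x => ?_)
      (ae_of_all _ fun x => ?_)
    · rw [Real.norm_eq_abs, abs_of_nonneg (sq_nonneg _)]; exact hle n x
    · refine tendsto_const_nhds.congr' ?_
      filter_upwards [hev x] with n hn
      rw [hn.eq_of_nhds]
  have j1 : Integrable (fun x => 2 * ‖gradient g x‖ ^ 2) (dens V ε) := i2.const_mul 2
  have j2 : Integrable (fun x => 2 * C ^ 2 * g x ^ 2) (dens V ε) := i1.const_mul _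
  have j3 : Integrable (fun x => 2 * ‖gradient g x‖ ^ 2 + 2 * C ^ 2 * g x ^ 2) (dens V ε) :=
    j1.add j2
  have j4 : ∀ n, AEStronglyMeasurable (fun x => ‖gradient (h n) x‖ ^ 2) (dens V ε) := fun n =>
    ((aux_grad_contDiff (m := 0) (hhs n) (by norm_num)).continuous.norm.pow 2).aestronglyMeasurable
  have T2 : Tendsto (fun n => ∫ x, ‖gradient (h n) x‖ ^ 2 ∂(dens V ε)) atTop
      (𝓝 (∫ x, ‖gradient g x‖ ^ 2 ∂(dens V ε))) := by
    refine tendsto_integral_of_dominated_convergence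
      (fun x => 2 * ‖gradient g x‖ ^ 2 + 2 * C ^ 2 * g x ^ 2) j4 j3 (fun n => ae_of_all _ fun x => ?_)
      (ae_of_all _ fun x => ?_)
    · rw [Real.norm_eq_abs, abs_of_nonneg (sq_nonneg _)]; exact hgle n x
    · refine tendsto_const_nhds.congr' ?_
      filter_upwards [hev x] with n hn
      rw [hn.gradient_eq]
  exact le_of_tendsto_of_tendsto' ((T1 _ i1).const_mul σ)
    (T2.add ((T1 _ i1.restrict).const_mul b)) fun n => H _ (hhs n) (hhc n)

lemma aux_sq (μ : Measure (Euc d)) [IsProbabilityMeasure μ] (f : Euc d → ℝ)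
    (h1 : Integrable f μ) (h2 : Integrable (fun x => f x ^ 2) μ) (a : ℝ) :
    Integrable (fun x => (f x - a) ^ 2) μ ∧
    ∫ x, (f x - a) ^ 2 ∂μ = ∫ x, f x ^ 2 ∂μ - 2 * a * ∫ x, f x ∂μ + a ^ 2 := by
  have e : (fun x => (f x - a) ^ 2) = fun x => (f x ^ 2 - 2 * a * f x) + a ^ 2 := by
    ext x; ring
  have j1 : Integrable (fun x => 2 * a * f x) μ := h1.const_mul _
  have j2 : Integrable (fun x => f x ^ 2 - 2 * a * f x) μ := h2.sub j1
  have j3 : Integrable (fun _ : Euc d => a ^ 2) μ := integrable_const _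
  rw [e]
  refine ⟨j2.add j3, ?_⟩
  rw [integral_add j2 j3, integral_sub h2 j1, integral_const_mul]
  simp

lemma aux_mass (V : Euc d → ℝ) (ε : ℝ) (hZ : Integrable (fun x => exp (-V x / ε)))
    {U : Set (Euc d)} (hU : MeasurableSet U) :
    dens V ε U = ENNReal.ofReal (∫ x in U, exp (-V x / ε)) := by
  unfold dens
  rw [withDensity_apply _ hU, ofReal_integral_eq_lintegral_ofReal hZ.restrict
    (ae_of_all _ fun x => (exp_pos _).le)]

/-- the Lyapunov function approach (Proposition 2.2 / Theorem 3.8 of [AOP]).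
If `W ≥ 1` is a Lyapunov function for the Langevin generator
`L f = -⟪∇V, ∇f⟫ + ε Δf`, i.e. `ε⁻¹ L W ≤ -σ W + b 1_U`, and the truncated Gibbs
measure on `U` satisfies a Poincaré inequality with constant `ρ > 0`, then the Gibbs
measure satisfies a Poincaré inequality with constant `σ ρ / (b + ρ)`. -/
theorem lyapunov_poincare
    {d : ℕ} (V W : Euc d → ℝ) (ε b σ ρ : ℝ) (U : Set (Euc d))
    (hV : ContDiff ℝ 2 V) (hε : 0 < ε)
    (hZ : Integrable (fun x => exp (-V x / ε)))
    (hW : ContDiff ℝ 2 W) (hW1 : ∀ x, 1 ≤ W x)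
    (hU : MeasurableSet U) (hb : 0 < b) (hσ : 0 < σ)
    (hLyap : ∀ x : Euc d,
      ε⁻¹ * (-⟪gradient V x, gradient W x⟫ + ε * lap W x)
        ≤ -σ * W x + b * U.indicator (fun _ => (1 : ℝ)) x)
    (hρ : 0 < ρ) (hPI : PoincareIneq (gibbsOn V ε U) ρ) :
    PoincareIneq (gibbs V ε) (σ * ρ / (b + ρ)) := by
  intro f hf if2 ig
  have hZ0 : 0 < ∫ x, exp (-V x / ε) := integral_exp_pos hZ
  set k : ℝ≥0∞ := (ENNReal.ofReal (∫ x, exp (-V x / ε)))⁻¹ with hk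
  have hgib : gibbs V ε = k • dens V ε := rfl
  have hk0 : k ≠ 0 := by simp [hk]
  have hkt : k ≠ ⊤ := by simp [hk, hZ0]
  have hkr : 0 < k.toReal := ENNReal.toReal_pos hk0 hkt
  have := aux_fin V ε hZ
  have hprob : IsProbabilityMeasure (gibbs V ε) := by
    constructor
    have h1 := aux_mass V ε hZ MeasurableSet.univ
    rw [setIntegral_univ] at h1
    rw [hgib, Measure.smul_apply, h1, smul_eq_mul, hk]
    exact ENNReal.inv_mul_cancel (by simpa using hZ0) ENNReal.ofReal_ne_top
  have if1 : Integrable f (gibbs V ε) := by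
    have : MemLp f 2 (gibbs V ε) :=
      (memLp_two_iff_integrable_sq hf.continuous.aestronglyMeasurable).2 if2
    exact this.integrable (by norm_num)
  have tr : ∀ q : Euc d → ℝ, Integrable q (gibbs V ε) → Integrable q (dens V ε) := by
    intro q hq
    rw [hgib] at hq
    exact (integrable_smul_measure hk0 hkt).1 hq
  have hUmass := aux_mass V ε hZ hU
  obtain ⟨c, hc⟩ : ∃ c : ℝ, ∫ x in U, (f x - c) ^ 2 ∂(dens V ε) ≤
      (1 / ρ) * ∫ x in U, ‖gradient f x‖ ^ 2 ∂(dens V ε) := by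
    by_cases hzero : dens V ε U = 0
    · refine ⟨0, ?_⟩
      rw [Measure.restrict_eq_zero.2 hzero]
      simp
    · have hgo : gibbsOn V ε U = (dens V ε U)⁻¹ • (dens V ε).restrict U := by
        rw [hUmass]
        unfold gibbsOn dens
        rw [restrict_withDensity hU]
      have hl0 : (dens V ε U)⁻¹ ≠ 0 := by simp
      have hlt : (dens V ε U)⁻¹ ≠ ⊤ := by simpa using hzero
      have hlr := ENNReal.toReal_pos hl0 hlt
      have h1 := hPI f hf
      rw [hgo] at h1
      have h2 := h1 ((tr _ if2).restrict.smul_measure hlt) ((tr _ ig).restrict.smul_measure hlt)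
      refine ⟨∫ y, f y ∂((dens V ε U)⁻¹ • (dens V ε).restrict U), ?_⟩
      generalize ∫ y, f y ∂((dens V ε U)⁻¹ • (dens V ε).restrict U) = c at h2 ⊢
      rw [integral_smul_measure, integral_smul_measure, smul_eq_mul, smul_eq_mul,
        mul_left_comm] at h2
      exact le_of_mul_le_mul_left h2 hlr
  obtain ⟨js, es⟩ := aux_sq (gibbs V ε) f if1 if2 c
  obtain ⟨-, em⟩ := aux_sq (gibbs V ε) f if1 if2 (∫ y, f y ∂(gibbs V ε))
  have hg : ContDiff ℝ 1 (fun x => f x - c) := hf.sub contDiff_const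
  have hgrad : gradient (fun x => f x - c) = gradient f := by
    ext1 x; simp [gradient, fderiv_sub_const]
  have main := aux_lim V (fun x => f x - c) ε b σ U
    (fun h hh hc => aux_cpt V W h ε b σ U hV hε hZ hW hW1 hU hb hLyap hh hc) hg (tr _ js)
    (by rw [hgrad]; exact tr _ ig)
  rw [hgrad] at main
  have hmono : ∫ x in U, ‖gradient f x‖ ^ 2 ∂(dens V ε) ≤ ∫ x, ‖gradient f x‖ ^ 2 ∂(dens V ε) :=
    setIntegral_le_integral (tr _ ig) (ae_of_all _ fun x => sq_nonneg _)
  have hvar : ∫ x, (f x - ∫ y, f y ∂(gibbs V ε)) ^ 2 ∂(gibbs V ε) ≤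
      ∫ x, (f x - c) ^ 2 ∂(gibbs V ε) := by
    rw [es, em]
    nlinarith [sq_nonneg (c - ∫ y, f y ∂(gibbs V ε))]
  refine hvar.trans ?_
  rw [hgib, integral_smul_measure, integral_smul_measure, smul_eq_mul, smul_eq_mul, mul_left_comm]
  refine mul_le_mul_of_nonneg_left ?_ hkr.le
  have h3 : b * ∫ x in U, (f x - c) ^ 2 ∂(dens V ε) ≤
      b * ((1 / ρ) * ∫ x, ‖gradient f x‖ ^ 2 ∂(dens V ε)) :=
    mul_le_mul_of_nonneg_left
      (hc.trans (mul_le_mul_of_nonneg_left hmono (by positivity))) hb.le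
  generalize ∫ x, ‖gradient f x‖ ^ 2 ∂(dens V ε) = A at *
  generalize ∫ x, (f x - c) ^ 2 ∂(dens V ε) = B at *
  have h4 : σ * B ≤ A + b * (1 / ρ * A) := by linarith
  have h5 : 1 / (σ * ρ / (b + ρ)) * A = (A + b * (1 / ρ * A)) / σ := by
    field_simp
    ring
  rw [h5, le_div_iff₀ hσ]
  linarith
end
end

section
/- Let d ≥ 2 and let V : ℝ^d → ℝ satisfy Assumptions 1–3. Then the set of all local minima of V is connected; in particular, V has a single connected set S of global minima. -/
open MeasureTheory Real Filter Metric Set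
open scoped RealInnerProductSpace ENNReal Topology

noncomputable section

variable {d : ℕ}

lemma aux_punct {d : ℕ} (hd : 2 ≤ d) (x : Euc d) {r : ℝ} (hr : 0 < r) :
    IsPreconnected (ball x r \ {x}) := by
  have hrank : 1 < Module.rank ℝ (Euc d) := by
    rw [← Module.finrank_eq_rank]
    simp only [finrank_euclideanSpace, Fintype.card_fin]
    exact_mod_cast hd
  have h0 := (isConnected_compl_singleton_of_one_lt_rank hrank (0 : Euc d)).isPreconnected
  have h1 := h0.image (fun y => x + (r / (1 + ‖y‖)) • y) (by
    apply Continuous.continuousOn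
    refine continuous_const.add (Continuous.smul (Continuous.div (f := fun _ => r)
      (g := fun y : Euc d => 1 + ‖y‖) continuous_const (by fun_prop) ?_) continuous_id)
    intro y; positivity)
  convert h1 using 1
  ext z
  simp only [Set.mem_sdiff, mem_ball, mem_singleton_iff, mem_image, mem_compl_iff]
  constructor
  · rintro ⟨hz, hzx⟩
    rw [dist_eq_norm] at hz
    have hp : 0 < r - ‖z - x‖ := by linarith
    refine ⟨(1 / (r - ‖z - x‖)) • (z - x), ?_, ?_⟩
    · simp only [smul_eq_zero, not_or, sub_eq_zero]
      exact ⟨by positivity, hzx⟩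
    · rw [norm_smul, smul_smul, Real.norm_of_nonneg (by positivity)]
      have : r / (1 + 1 / (r - ‖z - x‖) * ‖z - x‖) * (1 / (r - ‖z - x‖)) = 1 := by
        have : 1 + 1 / (r - ‖z - x‖) * ‖z - x‖ = r / (r - ‖z - x‖) := by
          field_simp; ring
        rw [this]; field_simp
      rw [this]; simp
  · rintro ⟨y, hy, rfl⟩
    have hy' : 0 < ‖y‖ := norm_pos_iff.2 hy
    constructor
    · rw [dist_eq_norm, add_sub_cancel_left, norm_smul, Real.norm_of_nonneg (by positivity),
        div_mul_eq_mul_div, div_lt_iff₀ (by positivity)]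
      nlinarith
    · simp only [add_eq_left, smul_eq_zero, not_or]
      exact ⟨by positivity, hy⟩

lemma aux_line {d : ℕ} {V : Euc d → ℝ} (hV : ContDiff ℝ 2 V) (y w : Euc d) (t : ℝ) :
    HasDerivAt (fun s : ℝ => V (y + s • w)) ⟪gradient V (y + t • w), w⟫ t := by
  have h := ((hV.differentiable (by norm_num)) (y + t • w)).hasFDerivAt
  rw [inner_gradient_left]
  have h2 : HasDerivAt (fun s : ℝ => y + s • w) w t := by
    simpa using ((hasDerivAt_id t).smul_const w).const_add y
  exact h.comp_hasDerivAt t h2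

lemma aux_dec {d : ℕ} {V : Euc d → ℝ} (hV : ContDiff ℝ 2 V) (y w : Euc d)
    (h : ∀ t ∈ Ioo (0:ℝ) 1, ⟪gradient V (y + t • w), w⟫ < 0) {s : ℝ} (hs : s ∈ Ioc (0:ℝ) 1) :
    V (y + s • w) < V y := by
  have := strictAntiOn_of_deriv_neg (convex_Icc (0:ℝ) 1) (f := fun s : ℝ => V (y + s • w))
    (fun t _ => (aux_line hV y w t).continuousAt.continuousWithinAt)
    (fun t ht => by
      rw [interior_Icc] at ht
      rw [(aux_line hV y w t).deriv]; exact h t ht)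
  simpa using this (by simp) ⟨hs.1.le, hs.2⟩ hs.1

lemma aux_grad {d : ℕ} {V : Euc d → ℝ} (hV : ContDiff ℝ 2 V) : ContDiff ℝ 1 (gradient V) := by
  have : ContDiff ℝ 1 (fderiv ℝ V) := hV.fderiv_right (by norm_num)
  exact (InnerProductSpace.toDual ℝ (Euc d)).symm.contDiff.comp this

lemma aux_max {d : ℕ} {V : Euc d → ℝ} (hV : ContDiff ℝ 2 V) (x : Euc d)
    (hx : gradient V x = 0) (hH : ∀ v : Euc d, v ≠ 0 → hessQ V x v < 0) :
    ∃ r > 0, ∀ y ∈ ball x r, y ≠ x → V y < V x := by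
  have hd := ((aux_grad hV).differentiable (by norm_num) x).hasFDerivAt
  -- uniform negativity
  obtain ⟨m, hm, hmb⟩ : ∃ m > 0, ∀ v : Euc d, hessQ V x v ≤ - m * ‖v‖ ^ 2 := by
    have hcont : Continuous (hessQ V x) := by unfold hessQ; fun_prop
    rcases (sphere (0 : Euc d) 1).eq_empty_or_nonempty with he | hne
    · refine ⟨1, one_pos, fun v => ?_⟩
      have : v = 0 := by
        by_contra hv
        have : (‖v‖⁻¹ • v) ∈ sphere (0 : Euc d) 1 := by
          simp [norm_smul, hv]
        rw [he] at this; exact this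
      subst this; simp [hessQ]
    · obtain ⟨u, hu, hmax⟩ := (isCompact_sphere (0 : Euc d) 1).exists_isMaxOn hne hcont.continuousOn
      refine ⟨- hessQ V x u, by have := hH u (by rintro rfl; simp at hu); linarith, fun v => ?_⟩
      by_cases hv : v = 0
      · subst hv; simp [hessQ]
      have h1 : (‖v‖⁻¹ • v) ∈ sphere (0 : Euc d) 1 := by simp [norm_smul, hv]
      have h2 : hessQ V x (‖v‖⁻¹ • v) ≤ hessQ V x u := hmax h1
      have h3 : hessQ V x v = ‖v‖ ^ 2 * hessQ V x (‖v‖⁻¹ • v) := by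
        have : ‖v‖ ≠ 0 := norm_ne_zero_iff.2 hv
        simp only [hessQ, map_smul, inner_smul_left, inner_smul_right]
        simp; field_simp
      rw [h3]; nlinarith [sq_nonneg ‖v‖]
  have ho := hd.isLittleO.def (c := m / 2) (by positivity)
  obtain ⟨r, hr, hb⟩ := Metric.eventually_nhds_iff_ball.1 ho
  refine ⟨r, hr, fun y hy hyx => ?_⟩
  have hw : y - x ≠ 0 := sub_ne_zero.2 hyx
  have key := aux_dec hV x (y - x) (fun t ht => ?_) (s := 1) (by simp)
  · simpa using key
  · have hmem : x + t • (y - x) ∈ ball x r := by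
      rw [mem_ball, dist_eq_norm] at hy ⊢
      rw [add_sub_cancel_left, norm_smul, Real.norm_of_nonneg ht.1.le]
      nlinarith [ht.1, ht.2, norm_nonneg (y - x)]
    have h1 := hb _ hmem
    rw [hx, sub_zero, add_sub_cancel_left, norm_smul, Real.norm_of_nonneg ht.1.le] at h1
    have h2 := real_inner_le_norm
      (gradient V (x + t • (y - x)) - fderiv ℝ (gradient V) x (t • (y - x))) (y - x)
    rw [inner_sub_left, map_smul, inner_smul_left] at h2
    have h3 := hmb (y - x)
    unfold hessQ at h3
    have h4 := mul_le_mul_of_nonneg_right h1 (norm_nonneg (y - x))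
    have h5 : 0 < ‖y - x‖ := norm_pos_iff.2 hw
    rw [map_smul] at h4
    simp only [conj_trivial] at h2
    have h6 := mul_le_mul_of_nonneg_left h3 ht.1.le
    have h7 : 0 < m * t * ‖y - x‖ ^ 2 := by have := ht.1; positivity
    nlinarith

lemma aux_reg {d : ℕ} {V : Euc d → ℝ} (hV : ContDiff ℝ 2 V) (x : Euc d)
    (hx : gradient V x ≠ 0) :
    ∃ r > 0, x ∈ closure {y | V y < V x} ∧ ∃ P : Set (Euc d), IsPreconnected P ∧ P ⊆ {y | V y < V x} ∧
      ball x r ∩ {y | V y < V x} ⊆ P := by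
  set v := gradient V x with hv
  have hc : Continuous (fun y => ⟪gradient V y, -v⟫) :=
    (aux_grad hV).continuous.inner continuous_const
  have hneg : ⟪gradient V x, -v⟫ < 0 := by
    rw [inner_neg_right, real_inner_self_eq_norm_sq]
    have := norm_pos_iff.2 hx
    have : 0 < ‖v‖ ^ 2 := by positivity
    linarith
  obtain ⟨ρ, hρ, hb⟩ := Metric.eventually_nhds_iff_ball.1 (hc.continuousAt.eventually_lt_const hneg)
  have hvp : 0 < ‖v‖ := norm_pos_iff.2 hx
  obtain ⟨s, hs, hsv⟩ : ∃ s > 0, s * ‖v‖ < ρ / 2 :=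
    ⟨ρ / (4 * ‖v‖), by positivity, by field_simp; norm_num⟩
  set w := s • (-v) with hw
  have hwn : ‖w‖ < ρ / 2 := by
    rw [hw, norm_smul, norm_neg, Real.norm_of_nonneg hs.le]; exact hsv
  have dec : ∀ y ∈ ball x (ρ / 2), ∀ t ∈ Ioc (0:ℝ) 1, V (y + t • w) < V y := by
    intro y hy t ht
    refine aux_dec hV y w (fun t ht => ?_) ht
    have hm : y + t • w ∈ ball x ρ := by
      rw [mem_ball, dist_eq_norm] at *
      have h1 : ‖y + t • w - x‖ ≤ ‖y - x‖ + ‖t • w‖ := by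
        rw [show y + t • w - x = (y - x) + t • w by abel]; exact norm_add_le _ _
      rw [norm_smul, Real.norm_of_nonneg ht.1.le] at h1
      nlinarith [ht.1, ht.2, norm_nonneg w]
    have := hb _ hm
    rw [hw, inner_smul_right]
    exact mul_neg_of_pos_of_neg hs this
  have hxw : V (x + w) < V x := by simpa using dec x (mem_ball_self (by positivity)) 1 (by simp)
  obtain ⟨r, hr, hrb⟩ := Metric.eventually_nhds_iff_ball.1
    (hV.continuous.continuousAt.eventually_lt_const hxw)
  refine ⟨min r (ρ / 2), by positivity, ?_, ?_⟩
  · have ht : Tendsto (fun t : ℝ => x + t • w) (𝓝[>] 0) (𝓝 x) := by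
      have : Continuous (fun t : ℝ => x + t • w) := by fun_prop
      have := this.tendsto 0
      simp only [zero_smul, add_zero] at this
      exact this.mono_left nhdsWithin_le_nhds
    refine mem_closure_of_tendsto ht ?_
    filter_upwards [Ioc_mem_nhdsGT (zero_lt_one : (0:ℝ) < 1)] with t ht
    exact dec x (mem_ball_self (by positivity)) t ht
  · refine ⟨⋃ y ∈ ball x (min r (ρ / 2)) ∩ {y | V y < V x},
      (segment ℝ y (y + w) ∪ ball (x + w) r), ?_, ?_, ?_⟩
    · have hmem : ∀ y ∈ ball x (min r (ρ / 2)) ∩ {y | V y < V x}, y + w ∈ ball (x + w) r := by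
        intro y hy
        have := hy.1
        rw [mem_ball, dist_eq_norm] at *
        rw [add_sub_add_right_eq_sub]
        exact this.trans_le (min_le_left _ _)
      rw [biUnion_eq_iUnion]
      refine isPreconnected_iUnion ⟨x + w, mem_iInter.2 fun y => Or.inr (mem_ball_self hr)⟩ fun y => ?_
      exact IsPreconnected.union (y + w) (right_mem_segment _ _ _) (hmem _ y.2)
        (convex_segment _ _).isPreconnected isPreconnected_ball
    · intro z hz
      simp only [mem_iUnion] at hz
      obtain ⟨y, hy, hz | hz⟩ := hz
      · rw [segment_eq_image'] at hz
        obtain ⟨t, ht, rfl⟩ := hz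
        simp only [add_sub_cancel_left, mem_ofPred_eq]
        rcases ht.1.eq_or_lt with h0 | h0
        · rw [← h0]; simpa using hy.2
        · exact (dec y (ball_subset_ball (min_le_right _ _) hy.1) t ⟨h0, ht.2⟩).trans hy.2
      · exact hrb _ hz
    · intro y hy
      simp only [mem_iUnion]
      exact ⟨y, hy, Or.inl (left_mem_segment _ _ _)⟩

lemma aux_crit {d : ℕ} {V : Euc d → ℝ} (hV : ContDiff ℝ 2 V)
    (hbd : BddBelow (range V)) {ν : ℝ} {𝒩 : Set (Euc d) → Set (Euc d)}
    (h1 : Assumption1 V ν 𝒩) (h2 : Assumption2 V 𝒩) (x : Euc d) (hx : gradient V x = 0) :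
    IsLocalMin V x ∨ ∃ r > 0, ∀ y ∈ ball x r, y ≠ x → V y < V x := by
  by_cases hN : x ∈ NSet V 𝒩
  · left
    simp only [NSet, mem_iUnion] at hN
    obtain ⟨p, hp, hxp⟩ := hN
    obtain ⟨hν, h1⟩ := h1
    obtain ⟨ho, -, -, hPL⟩ := h1 p hp
    have h := hPL x hxp
    rw [hx, norm_zero] at h
    filter_upwards [ho.mem_nhds hxp] with y hy
    have h3 : sInf (V '' 𝒩 (connectedComponentIn (localMinSet V) p)) ≤ V y :=
      csInf_le (hbd.mono (image_subset_range _ _)) (mem_image_of_mem _ hy)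
    nlinarith
  · right
    exact aux_max hV x hx (h2 x hN hx)

lemma aux_comp {d : ℕ} {V : Euc d → ℝ} (hV : Continuous V)
    (hK : ∀ t, IsCompact {x | V x ≤ t}) {a b : Euc d} {c : ℝ} (ha : V a ≤ c) (hb : V b ≤ c)
    (hT : ∀ t > c, ∃ C : Set (Euc d), IsPreconnected C ∧ a ∈ C ∧ b ∈ C ∧ C ⊆ {x | V x ≤ t}) :
    ∃ K : Set (Euc d), IsPreconnected K ∧ a ∈ K ∧ b ∈ K ∧ K ⊆ {x | V x ≤ c} := by
  let F : Set (Euc d) := {x | V x ≤ c}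
  have : CompactSpace F := isCompact_iff_compactSpace.1 (hK c)
  let a' : F := ⟨a, ha⟩
  let b' : F := ⟨b, hb⟩
  by_cases hmem : b' ∈ connectedComponent a'
  · refine ⟨Subtype.val '' connectedComponent a', ?_, ⟨a', mem_connectedComponent, rfl⟩,
      ⟨b', hmem, rfl⟩, ?_⟩
    · exact isPreconnected_connectedComponent.image _ continuous_subtype_val.continuousOn
    · rintro _ ⟨z, -, rfl⟩; exact z.2
  exfalso
  rw [connectedComponent_eq_iInter_isClopen, mem_iInter] at hmem
  push Not at hmem
  obtain ⟨⟨Z, hZ, haZ⟩, hbZ⟩ := hmem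
  have hP : IsCompact (Subtype.val '' Z) := hZ.1.isCompact.image continuous_subtype_val
  have hQ : IsCompact (Subtype.val '' Zᶜ) := hZ.2.isClosed_compl.isCompact.image continuous_subtype_val
  have hdisj : Disjoint (Subtype.val '' Z) (Subtype.val '' Zᶜ) :=
    (disjoint_image_iff Subtype.val_injective).2 disjoint_compl_right
  obtain ⟨O1, O2, ho1, ho2, hs1, hs2, hO⟩ := SeparatedNhds.of_isCompact_isCompact hP hQ hdisj
  have hcov : F ⊆ O1 ∪ O2 := by
    intro z hz
    by_cases h : (⟨z, hz⟩ : F) ∈ Z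
    · exact Or.inl (hs1 ⟨_, h, rfl⟩)
    · exact Or.inr (hs2 ⟨_, h, rfl⟩)
  obtain ⟨t, htc, ht⟩ : ∃ t > c, {x | V x ≤ t} ⊆ O1 ∪ O2 := by
    have hD : IsCompact ({x | V x ≤ c + 1} \ (O1 ∪ O2)) := (hK _).diff (ho1.union ho2)
    rcases ({x | V x ≤ c + 1} \ (O1 ∪ O2)).eq_empty_or_nonempty with he | hne
    · exact ⟨c + 1, by linarith, sdiff_eq_empty.1 he⟩
    · obtain ⟨m, hm, hmin⟩ := hD.exists_isMinOn hne hV.continuousOn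
      have hmc : c < V m := by
        by_contra h
        exact hm.2 (hcov (not_lt.1 h))
      have hm1 : V m ≤ c + 1 := hm.1
      refine ⟨(c + V m) / 2, by linarith, fun z hz => ?_⟩
      by_contra hzO
      have hz' : V z ≤ (c + V m) / 2 := hz
      have : V m ≤ V z := hmin ⟨show V z ≤ c + 1 by linarith, hzO⟩
      linarith
  obtain ⟨C, hC, haC, hbC, hCt⟩ := hT t htc
  have := hC.subset_left_of_subset_union ho1 ho2 hO (hCt.trans ht) ⟨a, haC, hs1 ⟨a', haZ, rfl⟩⟩
  exact hO.ne_of_mem (this hbC) (hs2 ⟨b', hbZ, rfl⟩) rfl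

lemma aux_pair {d : ℕ} (hd : 2 ≤ d) {V : Euc d → ℝ} (hV : ContDiff ℝ 2 V)
    (hK : ∀ t, IsCompact {x | V x ≤ t})
    (hcr : ∀ x, gradient V x = 0 →
      IsLocalMin V x ∨ ∃ r > 0, ∀ y ∈ ball x r, y ≠ x → V y < V x)
    {a b : Euc d} (ha : IsLocalMin V a) (hb : IsLocalMin V b) :
    ∃ t, t ⊆ localMinSet V ∧ a ∈ t ∧ b ∈ t ∧ IsPreconnected t := by
  have hVc := hV.continuous
  let T : Set ℝ := {t | ∃ C : Set (Euc d), IsPreconnected C ∧ a ∈ C ∧ b ∈ C ∧ C ⊆ {x | V x ≤ t}}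
  have hTbd : BddBelow T := ⟨V a, by rintro t ⟨C, -, haC, -, hC⟩; exact hC haC⟩
  have hTbd' : V b ∈ lowerBounds T := by rintro t ⟨C, -, -, hbC, hC⟩; exact hC hbC
  have hcpt : ∀ C : Set (Euc d), IsCompact C → IsPreconnected C → a ∈ C → b ∈ C →
      ∃ m ∈ C, V m ∈ T := by
    intro C hC hCp haC hbC
    obtain ⟨m, hm, hmax⟩ := hC.exists_isMaxOn ⟨a, haC⟩ hVc.continuousOn
    exact ⟨m, hm, C, hCp, haC, hbC, fun z hz => hmax hz⟩
  have hTne : T.Nonempty := by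
    obtain ⟨m, -, hm⟩ := hcpt (segment ℝ a b)
      (by rw [segment_eq_image']; exact isCompact_Icc.image (by fun_prop))
      (convex_segment _ _).isPreconnected (left_mem_segment _ _ _) (right_mem_segment _ _ _)
    exact ⟨_, hm⟩
  set c := sInf T with hc
  have hac : V a ≤ c := le_csInf hTne (by rintro t ⟨C, -, haC, -, hC⟩; exact hC haC)
  have hbc : V b ≤ c := le_csInf hTne hTbd'
  obtain ⟨K, hKp, haK, hbK, hKc⟩ := aux_comp hVc hK hac hbc (by
    intro t ht
    obtain ⟨s, ⟨C, h1, h2, h3, h4⟩, hst⟩ := exists_lt_of_csInf_lt hTne ht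
    exact ⟨C, h1, h2, h3, fun z hz => (h4 hz : V z ≤ s).trans hst.le⟩)
  by_cases hM : ∃ p ∈ K, IsLocalMin V p ∧ V p = c
  · obtain ⟨p, hpK, hpm, hpc⟩ := hM
    -- O : interior of {V ≥ c}
    let O : Set (Euc d) := interior {x | c ≤ V x}
    have hOm : ∀ y ∈ O ∩ K, IsLocalMin V y ∧ V y = c := by
      rintro y ⟨hyO, hyK⟩
      have h1 : y ∈ {x | c ≤ V x} := interior_subset hyO
      replace h1 : c ≤ V y := h1
      have h2 : V y ≤ c := hKc hyK
      have h3 : V y = c := le_antisymm h2 h1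
      refine ⟨?_, h3⟩
      filter_upwards [mem_interior_iff_mem_nhds.1 hyO] with z hz
      rw [h3]; exact hz
    let M : Set (Euc d) := {y | IsLocalMin V y ∧ V y = c}
    have hMO : M ⊆ O := by
      rintro y ⟨hym, hyc⟩
      rw [mem_interior_iff_mem_nhds]
      filter_upwards [hym] with z hz
      rw [← hyc]; exact hz
    have hMcl : closure M ⊆ M := by
      intro y hy
      have hcl : IsClosed {z | V z = c ∧ gradient V z = 0} :=
        (isClosed_eq hVc continuous_const).inter
          (isClosed_eq (aux_grad hV).continuous continuous_const)
      have hsub : M ⊆ {z | V z = c ∧ gradient V z = 0} := by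
        rintro z ⟨hzm, hzc⟩
        refine ⟨hzc, ?_⟩
        rw [gradient, hzm.fderiv_eq_zero, map_zero]
      obtain ⟨hyc, hyg⟩ := closure_minimal hsub hcl hy
      rcases hcr y hyg with h | ⟨r, hr, h⟩
      · exact ⟨h, hyc⟩
      · obtain ⟨z, hzM, hz⟩ := Metric.mem_closure_iff.1 hy r hr
        by_cases hzy : z = y
        · rwa [← hzy]
        · have := h z (by rwa [mem_ball, dist_comm]) hzy
          rw [hyc, hzM.2] at this
          exact absurd this (lt_irrefl _)
    have hKM : K ⊆ M := by
      intro y hyK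
      by_contra hyM
      obtain ⟨z, hzK, hzO, hzM⟩ := hKp O (closure M)ᶜ isOpen_interior isClosed_closure.isOpen_compl
        (fun z _ => by
          by_cases hz : z ∈ closure M
          · exact Or.inl (hMO (hMcl hz))
          · exact Or.inr hz)
        ⟨p, hpK, hMO ⟨hpm, hpc⟩⟩ ⟨y, hyK, fun h => hyM (hMcl h)⟩
      exact hzM (subset_closure (hOm z ⟨hzO, hzK⟩))
    exact ⟨K, fun z hz => (hKM hz).1, haK, hbK, hKp⟩
  exfalso
  push Not at hM
  have hac' : V a < c := lt_of_le_of_ne hac (hM a haK ha)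
  have hbc' : V b < c := lt_of_le_of_ne hbc (hM b hbK hb)
  let U : Set (Euc d) := {y | V y < c}
  have hU : IsOpen U := isOpen_lt hVc continuous_const
  have good : ∀ x ∈ K, ∃ r > 0, x ∈ closure U ∧ ∃ P : Set (Euc d), IsPreconnected P ∧ P ⊆ U ∧
      ball x r ∩ U ⊆ P := by
    intro x hxK
    have hxc : V x ≤ c := hKc hxK
    rcases hxc.lt_or_eq with h | h
    · obtain ⟨r, hr, hrb⟩ := Metric.isOpen_iff.1 hU x h
      exact ⟨r, hr, subset_closure h, ball x r, isPreconnected_ball, hrb, inter_subset_left⟩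
    by_cases hg : gradient V x = 0
    · rcases hcr x hg with hm | ⟨r, hr, hrb⟩
      · exact absurd h (hM x hxK hm)
      have hsub : ball x r \ {x} ⊆ U := fun y hy => by
        have := hrb y hy.1 hy.2
        rwa [h] at this
      have : Nontrivial (Euc d) := by
        have : Nonempty (Fin d) := ⟨⟨0, by omega⟩⟩
        infer_instance
      refine ⟨r, hr, ?_, ball x r \ {x}, aux_punct hd x hr, hsub, ?_⟩
      · rw [mem_closure_iff_nhdsWithin_neBot]
        have hne : (𝓝[≠] x).NeBot := inferInstance
        refine hne.mono ?_
        rw [nhdsWithin, nhdsWithin]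
        refine le_inf inf_le_left ?_
        rw [le_principal_iff]
        refine mem_of_superset ?_ hsub
        exact inter_mem (mem_inf_of_left (ball_mem_nhds x hr)) (mem_inf_of_right (mem_principal_self _))
      · rintro y ⟨hy, hyU⟩
        refine ⟨hy, ?_⟩
        rintro rfl
        exact absurd h (ne_of_lt hyU)
    · obtain ⟨r, hr, h1, h2⟩ := aux_reg hV x hg
      rw [h] at h1 h2
      exact ⟨r, hr, h1, h2⟩
  let A := connectedComponentIn U a
  have haA : a ∈ A := mem_connectedComponentIn hac'
  have hAp : IsPreconnected A := isPreconnected_connectedComponentIn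
  have hAU : A ⊆ U := connectedComponentIn_subset _ _
  have hAo : IsOpen A := hU.connectedComponentIn
  choose! r hr hcl P hP hPU hPb using good
  have hPA : ∀ x ∈ K, x ∈ closure A → ball x (r x) ∩ U ⊆ A := by
    intro x hxK hxA
    obtain ⟨z, hz, hzA⟩ := mem_closure_iff.1 hxA (ball x (r x)) isOpen_ball
      (mem_ball_self (hr x hxK))
    have hzP : z ∈ P x := hPb x hxK ⟨hz, hAU hzA⟩
    have : P x ⊆ A := by
      have h := (hP x hxK).subset_connectedComponentIn hzP (hPU x hxK)
      rwa [← connectedComponentIn_eq hzA] at h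
    exact (hPb x hxK).trans this
  have hKA : K ⊆ closure A := by
    intro y hyK
    by_contra hyA
    obtain ⟨z, hzK, hz1, hz2⟩ := hKp (⋃ x ∈ K ∩ closure A, ball x (r x)) (closure A)ᶜ
      (isOpen_biUnion fun _ _ => isOpen_ball) isClosed_closure.isOpen_compl
      (fun z hzK => by
        by_cases hz : z ∈ closure A
        · exact Or.inl (mem_biUnion ⟨hzK, hz⟩ (mem_ball_self (hr z hzK)))
        · exact Or.inr hz)
      ⟨a, haK, mem_biUnion ⟨haK, subset_closure haA⟩ (mem_ball_self (hr a haK))⟩ ⟨y, hyK, hyA⟩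
    apply hz2
    simp only [mem_iUnion] at hz1
    obtain ⟨x, ⟨hxK, hxA⟩, hzx⟩ := hz1
    exact closure_mono (hPA x hxK hxA) (isOpen_ball.inter_closure ⟨hzx, hcl z hzK⟩)
  have hbA : b ∈ A := hPA b hbK (hKA hbK) ⟨mem_ball_self (hr b hbK), hbc'⟩
  have hpath : IsPathConnected A := hAo.isConnected_iff_isPathConnected.1 ⟨⟨a, haA⟩, hAp⟩
  obtain ⟨γ, hγ⟩ := hpath.joinedIn a haA b hbA
  obtain ⟨m, hm, hmT⟩ := hcpt (range γ) (isCompact_range γ.continuous)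
    (isPreconnected_range γ.continuous) ⟨0, γ.source⟩ ⟨1, γ.target⟩
  obtain ⟨t, rfl⟩ := hm
  have h1 : V (γ t) < c := hAU (hγ t)
  exact absurd (csInf_le hTbd hmT) (not_le.2 h1)

/-- under Assumptions 1–3 and `d ≥ 2`, the set of all local minima of `V`
is connected (a single connected component of global minima). -/
theorem localMinSet_isConnected
    {d : ℕ} (hd : 2 ≤ d) (V : Euc d → ℝ)
    (hV : ContDiff ℝ 2 V) (hnc : ∃ x y : Euc d, V x ≠ V y)
    (ν : ℝ) (𝒩 : Set (Euc d) → Set (Euc d))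
    (h1 : Assumption1 V ν 𝒩) (h2 : Assumption2 V 𝒩)
    (R₀ ν_eb C_g : ℝ) (h3 : Assumption3 V R₀ ν_eb C_g) :
    IsConnected (localMinSet V) := by
  obtain ⟨-, -, -, -, hco, -⟩ := h3
  have hVc := hV.continuous
  have hK : ∀ t, IsCompact {x | V x ≤ t} := by
    intro t
    have h := hco.eventually (eventually_gt_atTop t)
    obtain ⟨s, hs, hst⟩ := mem_cocompact.1 h
    refine hs.of_isClosed_subset (isClosed_le hVc continuous_const) fun x hx => ?_
    by_contra hxs
    have h1 : t < V x := hst hxs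
    have h2 : V x ≤ t := hx
    linarith
  obtain ⟨x₀, hx₀⟩ := hVc.exists_forall_le hco
  have hbd : BddBelow (range V) := ⟨V x₀, by rintro _ ⟨y, rfl⟩; exact hx₀ y⟩
  refine ⟨⟨x₀, Eventually.of_forall hx₀⟩, isPreconnected_of_forall_pair fun a ha b hb => ?_⟩
  exact aux_pair hd hV hK (aux_crit hV hbd h1 h2) ha hb
end
end

section
/- Let d ≥ 2 and let V : ℝ^d → ℝ satisfy Assumptions 1–3, and let S be the set of local minima of V (which is then the connected set of global minima). Then S is a C² embedded submanifold of ℝ^d without boundary: there exists an integer k with 0 ≤ k ≤ d−1 such that for every p ∈ S there exist open sets U ∋ p and W in ℝ^d and a bijection φ : U → W such that φ and φ^{-1} are both C², and φ(S ∩ U) = W ∩ (ℝ^k × {0}). -/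
open MeasureTheory Real Filter Metric Set
open scoped RealInnerProductSpace ENNReal Topology

noncomputable section

variable {d : ℕ}

lemma mvt_le_aux {f f' : ℝ → ℝ} {a C : ℝ} (ha : 0 ≤ a)
    (h : ∀ s ∈ Icc 0 a, HasDerivAt f (f' s) s) (hC : ∀ s ∈ Icc 0 a, f' s ≤ C) :
    f a - f 0 ≤ C * a := by
  have := (convex_Icc (0:ℝ) a).image_sub_le_mul_sub_of_deriv_le (f := f)
    (fun s hs => (h s hs).continuousAt.continuousWithinAt)
    (fun s hs => (h s (interior_subset hs)).differentiableAt.differentiableWithinAt)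
    (C := C) (fun s hs => by
      rw [(h s (interior_subset hs)).deriv]; exact hC s (interior_subset hs))
    0 ⟨le_rfl, ha⟩ a ⟨ha, le_rfl⟩ ha
  simpa using this

section Chart
variable {E : Type*} [NormedAddCommGroup E] [InnerProductSpace ℝ E] [FiniteDimensional ℝ E]

lemma grad_path_aux {V : E → ℝ} {g : E} {γ : ℝ → E} {γ' : E} {s : ℝ}
    (h : HasGradientAt V g (γ s)) (hγ : HasDerivAt γ γ' s) :
    HasDerivAt (fun s => V (γ s)) (inner ℝ g γ') s := by
  have h1 : HasFDerivAt V (innerSL ℝ g) (γ s) := h.hasFDerivAt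
  exact h1.comp_hasDerivAt s hγ

lemma chart_crit_aux {V : E → ℝ} {G : E → E} {N : Set E} {p : E} {ν : ℝ} (hν : 0 < ν)
    (hG : ∀ x, HasGradientAt V (G x) x)
    (hPL : ∀ y ∈ N, ν * (V y - V p) ≤ ‖G y‖ ^ 2) (hmin : ∀ y ∈ N, V p ≤ V y)
    (K : Submodule ℝ E) (ψ : E → E) (ψ' : E → E →L[ℝ] E) (r : ℝ) (hr : 0 < r)
    (hψN : ∀ y ∈ ball (0:E) r, ψ y ∈ N)
    (hψ : ∀ y ∈ ball (0:E) r, HasFDerivAt ψ (ψ' y) y)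
    (hψ' : ∀ y ∈ ball (0:E) r, ∀ v ∈ K, ‖ψ' y v - v‖ ≤ (1/4) * ‖v‖)
    (h0 : G (ψ 0) = 0)
    (hLip : ∀ y ∈ ball (0:E) r, ∀ z ∈ ball (0:E) r, y ∈ K → z ∈ K →
      ‖G (ψ y) - G (ψ z)‖ ≤ (ν / 32) * ‖y - z‖)
    (y : E) (hyr : y ∈ ball (0:E) (r/2)) (hyK : y ∈ K) (hv : G (ψ y) ∈ K) : G (ψ y) = 0 := by
  set v := G (ψ y) with hvdef
  have hyr' : ‖y‖ < r/2 := by simpa using hyr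
  have hyb : y ∈ ball (0:E) r := by simp; linarith [norm_nonneg y]
  have h0b : (0:E) ∈ ball (0:E) r := by simp [hr]
  have hvle : ‖v‖ ≤ ν/32 * ‖y‖ := by
    have := hLip y hyb 0 h0b hyK K.zero_mem
    simpa [h0] using this
  -- a = 8/ν
  have hin : ∀ s ∈ Icc (0:ℝ) (8/ν), y - s • v ∈ ball (0:E) r := by
    intro s hs
    have h1 : ‖s • v‖ ≤ ‖y‖ := by
      rw [norm_smul, Real.norm_of_nonneg hs.1]
      calc s * ‖v‖ ≤ (8/ν) * (ν/32*‖y‖) := by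
            apply mul_le_mul hs.2 hvle (norm_nonneg _) (by positivity)
        _ = ‖y‖/4 := by field_simp; ring
        _ ≤ ‖y‖ := by linarith [norm_nonneg y]
    have := norm_sub_le y (s • v)
    simp; linarith
  have hK : ∀ s : ℝ, y - s • v ∈ K := fun s => K.sub_mem hyK (K.smul_mem s hv)
  have hder : ∀ s ∈ Icc (0:ℝ) (8/ν), HasDerivAt (fun s : ℝ => V (ψ (y - s • v)))
      (- inner ℝ (G (ψ (y - s • v))) (ψ' (y - s • v) v)) s := by
    intro s hs
    have h1 : HasDerivAt (fun s : ℝ => y - s • v) (-v) s := by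
      simpa using ((hasDerivAt_id s).smul_const v).const_sub y
    have h2 := (hψ _ (hin s hs)).comp_hasDerivAt s h1
    have h3 := grad_path_aux (γ := fun s : ℝ => ψ (y - s • v)) (hG (ψ (y - s • v))) h2
    simpa using h3
  have hbd : ∀ s ∈ Icc (0:ℝ) (8/ν),
      - inner ℝ (G (ψ (y - s • v))) (ψ' (y - s • v) v) ≤ - (‖v‖^2/4) := by
    intro s hs
    set e1 := G (ψ (y - s • v)) - v with he1
    set e2 := ψ' (y - s • v) v - v with he2
    have h1 : ‖e1‖ ≤ (1/4) * ‖v‖ := by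
      have := hLip _ (hin s hs) y hyb (hK s) hyK
      have h4 : ‖y - s • v - y‖ = s * ‖v‖ := by
        rw [show y - s • v - y = -(s • v) by abel, norm_neg, norm_smul, Real.norm_of_nonneg hs.1]
      rw [h4] at this
      calc ‖e1‖ ≤ ν/32 * (s * ‖v‖) := this
        _ ≤ ν/32 * ((8/ν) * ‖v‖) := by gcongr; exact hs.2
        _ = (1/4)*‖v‖ := by field_simp; ring
    have h2 : ‖e2‖ ≤ (1/4) * ‖v‖ := hψ' _ (hin s hs) v hv
    have e1' : G (ψ (y - s • v)) = v + e1 := by rw [he1]; abel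
    have e2' : ψ' (y - s • v) v = v + e2 := by rw [he2]; abel
    rw [e1', e2', inner_add_left, inner_add_right, inner_add_right, real_inner_self_eq_norm_sq]
    have a1 := abs_le.1 (abs_real_inner_le_norm v e2)
    have a2 := abs_le.1 (abs_real_inner_le_norm e1 v)
    have a3 := abs_le.1 (abs_real_inner_le_norm e1 e2)
    have n0 := norm_nonneg v
    have b1 : ‖v‖ * ‖e2‖ ≤ ‖v‖ * ((1/4)*‖v‖) := by gcongr
    have b2 : ‖e1‖ * ‖v‖ ≤ ((1/4)*‖v‖) * ‖v‖ := by gcongr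
    have b3 : ‖e1‖ * ‖e2‖ ≤ ((1/4)*‖v‖) * ((1/4)*‖v‖) := by gcongr
    nlinarith
  have := mvt_le_aux (by positivity) hder hbd
  simp only [zero_smul, sub_zero] at this
  have hm := hmin _ (hψN _ (hin (8/ν) ⟨by positivity, le_rfl⟩))
  have hp := hPL _ (hψN y hyb)
  rw [← hvdef] at hp
  have h5 : -(‖v‖^2/4) * (8/ν) = - (2 * ‖v‖^2) / ν := by field_simp; ring
  rw [h5] at this
  have h6 : 2 * ‖v‖^2/ν ≤ V (ψ y) - V p := by
    have : -(2*‖v‖^2)/ν = -(2 * ‖v‖^2/ν) := by ring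
    linarith
  have h7 : 2 * ‖v‖^2 ≤ ν * (V (ψ y) - V p) := by
    rw [div_le_iff₀ hν] at h6; linarith
  have h8 : ‖v‖^2 ≤ 0 := by linarith
  have : ‖v‖ = 0 := by nlinarith [norm_nonneg v]
  simpa using this

lemma chart_aux {V : E → ℝ} {G : E → E} {N : Set E} {p : E} {ν : ℝ} (hν : 0 < ν)
    (hG : ∀ x, HasGradientAt V (G x) x) (hN : IsOpen N) (hpN : p ∈ N)
    (hGC : ∀ x ∈ N, ContDiffAt ℝ 2 G x)
    (hPL : ∀ y ∈ N, ν * (V y - V p) ≤ ‖G y‖ ^ 2) (hmin : ∀ y ∈ N, V p ≤ V y)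
    (hGp : G p = 0)
    (hsymm : ∀ v w, inner ℝ (fderiv ℝ G p v) w = inner ℝ v (fderiv ℝ G p w)) :
    ∃ (U W : Set E) (φ ψ : E → E), p ∈ U ∧ IsOpen U ∧ IsOpen W ∧ U ⊆ N ∧
      ContDiffOn ℝ 2 φ U ∧ ContDiffOn ℝ 2 ψ W ∧
      (∀ x ∈ U, ψ (φ x) = x) ∧ (∀ y ∈ W, φ (ψ y) = y) ∧ φ '' U = W ∧
      (∀ x ∈ U, G x = 0 ↔ φ x ∈ (fderiv ℝ G p).ker) ∧
      (∀ x ∈ U, G x = 0 → Module.finrank ℝ (fderiv ℝ G x).ker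
        = Module.finrank ℝ (fderiv ℝ G p).ker) := by
  set H := fderiv ℝ G p with hH
  set K : Submodule ℝ E := H.ker with hK
  set Q : E →L[ℝ] E := K.starProjection with hQ
  have hQmem : ∀ x, Q x ∈ K := fun x => K.starProjection_apply_mem x
  have hQid : ∀ x ∈ K, Q x = x := fun x hx => Submodule.starProjection_eq_self_iff.2 hx
  have hQnorm : ∀ x, ‖Q x‖ ≤ ‖x‖ := fun x => K.norm_starProjection_apply_le x
  have hQH : ∀ x, Q (H x) = 0 := by
    intro x
    rw [hQ, Submodule.starProjection_apply_eq_zero_iff, Submodule.mem_orthogonal]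
    intro u hu
    rw [← hsymm u x]
    have : H u = 0 := hu
    rw [this, inner_zero_left]
  have hHQ : ∀ x, H (Q x) = 0 := fun x => hQmem x
  set Φ : E → E := fun x => G x - Q (G x) + Q (x - p) with hΦ
  have hΦC : ∀ x ∈ N, ContDiffAt ℝ 2 Φ x := by
    intro x hx
    have := hGC x hx
    simp only [hΦ]
    fun_prop
  have hGD : ∀ x ∈ N, HasFDerivAt G (fderiv ℝ G x) x := fun x hx =>
    ((hGC x hx).differentiableAt (by norm_num)).hasFDerivAt
  have hΦD : ∀ x ∈ N, HasFDerivAt Φ (fderiv ℝ G x - Q ∘L fderiv ℝ G x + Q) x := by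
    intro x hx
    have h1 := hGD x hx
    have h2 : HasFDerivAt (fun x => Q (x - p)) Q x := by
      exact Q.hasFDerivAt.comp x ((hasFDerivAt_id x).sub_const p)
    exact (h1.sub (Q.hasFDerivAt.comp x h1)).add h2
  have hinj : Function.Injective (H + Q).toLinearMap := by
    rw [← LinearMap.ker_eq_bot, LinearMap.ker_eq_bot']
    intro x hx
    have hx' : H x + Q x = 0 := hx
    have h1 : Q x = 0 := by
      have := congrArg Q hx'
      rw [map_add, hQH, map_zero, zero_add, hQid _ (hQmem x)] at this
      exact this
    rw [h1, add_zero] at hx'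
    rw [← hQid x hx']; exact h1
  let Λ : E ≃L[ℝ] E := (LinearEquiv.ofInjectiveEndo _ hinj).toContinuousLinearEquiv
  have hΛ : ∀ x, Λ x = H x + Q x := fun x => rfl
  have hΦp : HasFDerivAt Φ (Λ : E →L[ℝ] E) p := by
    convert hΦD p hpN using 1
    ext x
    simp [hΛ, ← hH, hQH]
  have hΦ0 : Φ p = 0 := by simp [hΦ, hGp]
  let e := (hΦC p hpN).toOpenPartialHomeomorph Φ hΦp (by norm_num)
  have hecoe : (e : E → E) = Φ := rfl
  have hps : p ∈ e.source := ContDiffAt.mem_toOpenPartialHomeomorph_source _ _ _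
  have h0t : (0:E) ∈ e.target := by rw [← hΦ0, ← hecoe]; exact e.map_source hps
  have hes0 : e.symm 0 = p := by rw [← hΦ0, ← hecoe]; exact e.left_inv hps
  have hsC : ContDiffAt ℝ 2 e.symm 0 := by
    apply e.contDiffAt_symm (f₀' := Λ) h0t
    · rw [hes0]; exact hΦp
    · rw [hes0]; exact hΦC p hpN
  have hsD : HasFDerivAt e.symm (Λ.symm : E →L[ℝ] E) 0 := by
    apply e.hasFDerivAt_symm h0t
    rw [hes0]; exact hΦp
  have hΛs : ∀ v ∈ K, Λ.symm v = v := by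
    intro v hv
    rw [ContinuousLinearEquiv.symm_apply_eq, hΛ, hQid v hv, show H v = 0 from hv, zero_add]
  -- eventual properties
  have ev1 : ∀ᶠ y in 𝓝 (0:E), ContDiffAt ℝ 2 e.symm y := hsC.eventually (by decide)
  have ev2 : ∀ᶠ y in 𝓝 (0:E), y ∈ e.target := e.open_target.mem_nhds h0t
  have ev3 : ∀ᶠ y in 𝓝 (0:E), e.symm y ∈ N := by
    apply hsC.continuousAt.eventually
    rw [hes0]; exact hN.mem_nhds hpN
  have ev4 : ∀ᶠ y in 𝓝 (0:E), ‖fderiv ℝ e.symm y - fderiv ℝ e.symm 0‖ < 1/4 := by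
    have hc : ContinuousAt (fderiv ℝ e.symm) 0 :=
      (hsC.fderiv_right (m := 1) (by norm_num)).continuousAt
    have := Metric.tendsto_nhds.1 hc (1/4) (by norm_num)
    simpa [dist_eq_norm] using this
  have hΓ : HasStrictFDerivAt (fun y => G (e.symm (Q y))) (0 : E →L[ℝ] E) 0 := by
    have hc : ContDiffAt ℝ 2 (fun y => G (e.symm (Q y))) 0 := by
      have h1 : ContDiffAt ℝ 2 (fun y => e.symm (Q y)) 0 := by
        apply ContDiffAt.comp (g := e.symm) (f := Q) 0 (by simpa using hsC) Q.contDiff.contDiffAt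
      apply ContDiffAt.comp (g := G) (f := fun y => e.symm (Q y)) 0 _ h1
      simp only [map_zero, hes0]; exact hGC p hpN
    apply hc.hasStrictFDerivAt' _ (by norm_num)
    have h1 : HasFDerivAt (fun y => e.symm (Q y)) ((Λ.symm : E →L[ℝ] E) ∘L Q) 0 := by
      apply HasFDerivAt.comp (g := e.symm) (f := Q) 0 (by simpa using hsD) Q.hasFDerivAt
    have h2 : HasFDerivAt (fun y => G (e.symm (Q y))) (H ∘L ((Λ.symm : E →L[ℝ] E) ∘L Q)) 0 := by
      apply HasFDerivAt.comp (g := G) (f := fun y => e.symm (Q y)) 0 _ h1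
      simp only [map_zero, hes0]; exact hGD p hpN
    convert h2 using 1
    ext x
    simp [hΛs _ (hQmem x), hHQ]
  obtain ⟨s, hs, hsLip⟩ := hΓ.exists_lipschitzOnWith_of_nnnorm_lt (Real.toNNReal (ν/32))
    (by simpa using hν)
  obtain ⟨r, hr, hball⟩ := Metric.eventually_nhds_iff_ball.1
    (ev1.and (ev2.and (ev3.and (ev4.and hs))))
  have hfd0 : fderiv ℝ e.symm 0 = (Λ.symm : E →L[ℝ] E) := hsD.fderiv
  have hsDy : ∀ y ∈ ball (0:E) r, HasFDerivAt e.symm (fderiv ℝ e.symm y) y := fun y hy =>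
    ((hball y hy).1.differentiableAt (by norm_num)).hasFDerivAt
  have hΦK : ∀ x, Φ x ∈ K ↔ G x ∈ K := by
    intro x
    constructor
    · intro h
      have : G x = Φ x + Q (G x) - Q (x - p) := by simp only [hΦ]; abel
      rw [this]
      exact K.sub_mem (K.add_mem h (hQmem _)) (hQmem _)
    · intro h
      exact K.add_mem (K.sub_mem h (hQmem _)) (hQmem _)
  have hright : ∀ y ∈ ball (0:E) r, Φ (e.symm y) = y := fun y hy => e.right_inv (hball y hy).2.1
  have key : ∀ y ∈ ball (0:E) (r/2), y ∈ K → G (e.symm y) = 0 := by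
    intro y hy hyK
    have hyr : y ∈ ball (0:E) r := ball_subset_ball (by linarith) hy
    refine chart_crit_aux hν hG hPL hmin K e.symm (fderiv ℝ e.symm) r hr
      (fun y hy => (hball y hy).2.2.1) hsDy ?_ (by rw [hes0, hGp]) ?_ y hy hyK ?_
    · intro y hy v hv
      have h1 := (hball y hy).2.2.2.1
      calc ‖fderiv ℝ e.symm y v - v‖ = ‖(fderiv ℝ e.symm y - fderiv ℝ e.symm 0) v‖ := by
            rw [hfd0]; simp [hΛs v hv]
        _ ≤ _ := ContinuousLinearMap.le_of_opNorm_le _ h1.le v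
    · intro y hy z hz hyK hzK
      have := hsLip.dist_le_mul y (hball y hy).2.2.2.2 z (hball z hz).2.2.2.2
      simp only [hQid y hyK, hQid z hzK, dist_eq_norm] at this
      rwa [Real.coe_toNNReal _ (by positivity)] at this
    · rw [← hΦK, hright y hyr]; exact hyK
  have hsub : ball (0:E) (r/2) ⊆ ball (0:E) r := ball_subset_ball (by linarith)
  refine ⟨e.source ∩ e ⁻¹' (ball 0 (r/2)), ball 0 (r/2), Φ, e.symm, ⟨hps, ?_⟩,
    e.isOpen_inter_preimage isOpen_ball, isOpen_ball, ?_, ?_, ?_, ?_, ?_, ?_, ?_, ?_⟩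
  · rw [mem_preimage, hecoe, hΦ0]; simp [hr]
  · rintro x ⟨hx, hx'⟩
    have := (hball _ (hsub hx')).2.2.1
    rwa [e.left_inv hx] at this
  · rintro x ⟨hx, hx'⟩
    have := (hball _ (hsub hx')).2.2.1
    rw [e.left_inv hx] at this
    exact (hΦC x this).contDiffWithinAt
  · intro y hy
    exact (hball y (hsub hy)).1.contDiffWithinAt
  · rintro x ⟨hx, hx'⟩
    exact e.left_inv hx
  · intro y hy
    exact hright y (hsub hy)
  · apply Subset.antisymm
    · rintro _ ⟨x, hx, rfl⟩
      exact hx.2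
    · intro y hy
      have ht := (hball y (hsub hy)).2.1
      refine ⟨e.symm y, ⟨e.map_target ht, ?_⟩, e.right_inv ht⟩
      rw [mem_preimage, e.right_inv ht]; exact hy
  · rintro x ⟨hx, hx'⟩
    constructor
    · intro h
      rw [hΦK, h]; exact K.zero_mem
    · intro h
      have := key _ hx' h
      rwa [e.left_inv hx] at this
  · rintro x ⟨hx, hx'⟩ hGx
    have hxN : x ∈ N := by
      have := (hball _ (hsub hx')).2.2.1
      rwa [e.left_inv hx] at this
    have hyK : Φ x ∈ K := by rw [hΦK, hGx]; exact K.zero_mem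
    have hΦDx := hΦD x hxN
    have hψD : HasFDerivAt e.symm (fderiv ℝ e.symm (Φ x)) (Φ x) := hsDy _ (hsub hx')
    have hexx : e.symm (Φ x) = x := e.left_inv hx
    set B := fderiv ℝ e.symm (Φ x) with hB
    set A := fderiv ℝ G x - Q ∘L fderiv ℝ G x + Q with hA
    have hBA : ∀ v, B (A v) = v := by
      have h1 : HasFDerivAt (fun z => e.symm (Φ z)) (B ∘L A) x := hψD.comp x hΦDx
      have h2 : HasFDerivAt (fun z => e.symm (Φ z)) (ContinuousLinearMap.id ℝ E) x := by
        apply (hasFDerivAt_id x).congr_of_eventuallyEq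
        filter_upwards [e.open_source.mem_nhds hx] with z hz using e.left_inv hz
      intro v
      exact DFunLike.congr_fun (h1.unique h2) v
    have hAB : ∀ v, A (B v) = v := by
      have h1 : HasFDerivAt (fun z => Φ (e.symm z)) (A ∘L B) (Φ x) := by
        apply HasFDerivAt.comp (g := Φ) (Φ x) _ hψD
        rw [hexx]; exact hΦDx
      have h2 : HasFDerivAt (fun z => Φ (e.symm z)) (ContinuousLinearMap.id ℝ E) (Φ x) := by
        apply (hasFDerivAt_id (Φ x)).congr_of_eventuallyEq
        filter_upwards [isOpen_ball.mem_nhds (hsub hx')] with z hz using hright z hz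
      intro v
      exact DFunLike.congr_fun (h1.unique h2) v
    have hzero : ∀ v ∈ K, fderiv ℝ G x (B v) = 0 := by
      have h1 : HasFDerivAt (fun z => e.symm (Q z)) (B ∘L Q) (Φ x) := by
        apply HasFDerivAt.comp (g := e.symm) (f := Q) (Φ x) _ Q.hasFDerivAt
        rw [hQid _ hyK]; exact hψD
      have h2 : HasFDerivAt (fun z => G (e.symm (Q z))) (fderiv ℝ G x ∘L (B ∘L Q)) (Φ x) := by
        apply HasFDerivAt.comp (g := G) (f := fun z => e.symm (Q z)) (Φ x) _ h1
        rw [hQid _ hyK, hexx]; exact hGD x hxN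
      have h3 : HasFDerivAt (fun z => G (e.symm (Q z))) (0 : E →L[ℝ] E) (Φ x) := by
        apply (hasFDerivAt_const (0:E) (Φ x)).congr_of_eventuallyEq
        filter_upwards [isOpen_ball.mem_nhds hx'] with z hz
        apply key _ _ (hQmem z)
        have := hQnorm z
        simp only [mem_ball, dist_zero_right] at hz ⊢
        linarith
      intro v hv
      have := DFunLike.congr_fun (h2.unique h3) v
      simpa [hQid v hv] using this
    apply le_antisymm
    · have hmap : ∀ v ∈ (fderiv ℝ G x).ker, A.toLinearMap v ∈ K := by
        intro v hv
        have hv' : fderiv ℝ G x v = 0 := hv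
        have : A v = Q v := by simp [hA, hv']
        change A v ∈ K
        rw [this]; exact hQmem v
      apply LinearMap.finrank_le_finrank_of_injective (f := A.toLinearMap.restrict hmap)
      intro u v huv
      have : A u = A v := congrArg Subtype.val huv
      apply Subtype.ext
      rw [← hBA u, ← hBA v, this]
    · have hmap : ∀ v ∈ K, B.toLinearMap v ∈ (fderiv ℝ G x).ker := fun v hv => hzero v hv
      apply LinearMap.finrank_le_finrank_of_injective (f := B.toLinearMap.restrict hmap)
      intro u v huv
      have : B u = B v := congrArg Subtype.val huv
      apply Subtype.ext
      rw [← hAB u, ← hAB v, this]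
end Chart

section Descent
variable {E : Type*} [NormedAddCommGroup E] [InnerProductSpace ℝ E] [FiniteDimensional ℝ E]
set_option linter.unusedSectionVars false

lemma exists_step_aux {G : E → E} (hG : ContDiff ℝ 1 G) :
    ∃ η : C(E, ℝ), ∀ x, 0 < η x ∧ ∀ s ∈ Icc 0 (η x),
      ‖G x‖ ^ 2 / 2 ≤ inner ℝ (G (x - s • G x)) (G x) := by
  apply exists_continuous_forall_mem_convex_of_local_const
    (t := fun x => {c : ℝ | 0 < c ∧ ∀ s ∈ Icc 0 c,
      ‖G x‖ ^ 2 / 2 ≤ inner ℝ (G (x - s • G x)) (G x)})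
  · intro x
    apply Set.OrdConnected.convex
    constructor
    rintro a ⟨ha, ha'⟩ b ⟨hb, hb'⟩ c ⟨hc, hc'⟩
    exact ⟨ha.trans_le hc, fun s hs => hb' s ⟨hs.1, hs.2.trans hc'⟩⟩
  · intro x
    obtain ⟨L, t, ht, hL⟩ := hG.contDiffAt.exists_lipschitzOnWith (x := x)
    obtain ⟨ρ, hρ, hρt⟩ := Metric.mem_nhds_iff.1 ht
    set g := ‖G x‖ + 1 with hg
    have hgpos : 0 < g := by positivity
    set c := min (1 / (2 * ((L:ℝ) + 1))) (ρ / (2 * g)) with hc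
    have hcpos : 0 < c := by positivity
    refine ⟨c, ?_⟩
    have e1 : ∀ᶠ y in 𝓝 x, ‖G y‖ < g :=
      (hG.continuous.norm.continuousAt (x := x)).eventually_lt_const (by simp [hg])
    have e2 : ∀ᶠ y in 𝓝 x, y ∈ ball x (ρ/2) := ball_mem_nhds x (by positivity)
    filter_upwards [e1, e2] with y hy1 hy2
    refine ⟨hcpos, fun s hs => ?_⟩
    have hns : ‖s • G y‖ = s * ‖G y‖ := by rw [norm_smul, Real.norm_of_nonneg hs.1]
    have hyt : y ∈ t := hρt (ball_subset_ball (by linarith) hy2)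
    have hy't : y - s • G y ∈ t := by
      apply hρt
      have h1 : s * ‖G y‖ ≤ ρ/2 := by
        calc s * ‖G y‖ ≤ (ρ/(2*g)) * g := by
              apply mul_le_mul (hs.2.trans (min_le_right _ _)) hy1.le (norm_nonneg _) (by positivity)
          _ = ρ/2 := by field_simp
      rw [mem_ball, dist_eq_norm] at hy2 ⊢
      calc ‖y - s • G y - x‖ = ‖(y - x) - s • G y‖ := by congr 1; abel
        _ ≤ ‖y - x‖ + ‖s • G y‖ := norm_sub_le _ _
        _ < ρ := by rw [hns]; linarith
    have h2 := hL.dist_le_mul _ hy't _ hyt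
    rw [dist_eq_norm, dist_eq_norm, show y - s • G y - y = -(s • G y) by abel, norm_neg, hns] at h2
    set e := G (y - s • G y) - G y with he
    have h3 : ‖e‖ ≤ ‖G y‖ / 2 := by
      have h4 : (L:ℝ) * s ≤ 1/2 := by
        calc (L:ℝ) * s ≤ (L + 1) * (1 / (2 * ((L:ℝ) + 1))) := by
              apply mul_le_mul (by linarith) (hs.2.trans (min_le_left _ _)) hs.1 (by positivity)
          _ = 1/2 := by field_simp
      calc ‖e‖ ≤ L * (s * ‖G y‖) := h2
        _ = (L * s) * ‖G y‖ := by ring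
        _ ≤ 1/2 * ‖G y‖ := by gcongr
        _ = _ := by ring
    have h5 : G (y - s • G y) = G y + e := by rw [he]; abel
    rw [h5, inner_add_left, real_inner_self_eq_norm_sq]
    have a1 := abs_le.1 (abs_real_inner_le_norm e (G y))
    have b1 : ‖e‖ * ‖G y‖ ≤ ‖G y‖/2 * ‖G y‖ := by gcongr
    nlinarith

/-- gradient descent map -/
lemma exists_descent_aux {V : E → ℝ} {G : E → E} (hG : ∀ x, HasGradientAt V (G x) x)
    (hGC : ContDiff ℝ 1 G) :
    ∃ (T : E → E) (η : E → ℝ), Continuous T ∧ (∀ x, 0 < η x) ∧ (∀ x, G x = 0 → T x = x) ∧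
      (∀ x, G (T x) = 0 → G x = 0) ∧ (∀ x, ‖T x - x‖ = η x * ‖G x‖) ∧
      (∀ x, V (T x) ≤ V x - η x * ‖G x‖ ^ 2 / 2) := by
  obtain ⟨η, hη⟩ := exists_step_aux hGC
  refine ⟨fun x => x - η x • G x, η, ?_, fun x => (hη x).1, ?_, ?_, ?_, ?_⟩
  · have := hGC.continuous
    fun_prop
  · intro x hx; simp [hx]
  · intro x hx
    have := (hη x).2 (η x) ⟨(hη x).1.le, le_rfl⟩
    rw [hx, inner_zero_left] at this
    have : ‖G x‖ = 0 := by nlinarith [norm_nonneg (G x)]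
    simpa using this
  · intro x
    rw [show x - η x • G x - x = -(η x • G x) by abel, norm_neg, norm_smul,
      Real.norm_of_nonneg (hη x).1.le]
  · intro x
    have h := mvt_le_aux (f := fun s : ℝ => V (x - s • G x))
      (f' := fun s => inner ℝ (G (x - s • G x)) (-(G x))) (a := η x) (C := -(‖G x‖^2/2))
      (hη x).1.le
      (fun s _ => grad_path_aux (γ := fun s : ℝ => x - s • G x) (hG _)
        (by simpa using ((hasDerivAt_id s).smul_const (G x)).const_sub x))
      (fun s hs => by
        rw [inner_neg_right]; linarith [(hη x).2 s hs])
    simp only [zero_smul, sub_zero] at h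
    nlinarith

lemma stable_aux {V : E → ℝ} {G : E → E} {N : Set E} {p : E} {ν : ℝ} (hν : 0 < ν)
    (hVc : Continuous V)
    (hN : IsOpen N) (hpN : p ∈ N)
    (hPL : ∀ y ∈ N, ν * (V y - V p) ≤ ‖G y‖ ^ 2) (hmin : ∀ y ∈ N, V p ≤ V y)
    (T : E → E) (η : E → ℝ) (hT : Continuous T) (hη : ∀ x, 0 < η x) (hTp : T p = p)
    (hTn : ∀ x, ‖T x - x‖ = η x * ‖G x‖)
    (hTV : ∀ x, V (T x) ≤ V x - η x * ‖G x‖ ^ 2 / 2)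
    (O : Set E) (hO : O ∈ 𝓝 p) : ∀ᶠ x in 𝓝 p, ∀ n : ℕ, T^[n] x ∈ O := by
  obtain ⟨r, hr, hrO⟩ := Metric.mem_nhds_iff.1 (Filter.inter_mem hO (hN.mem_nhds hpN))
  have hTc : T ⁻¹' (ball p r) ∈ 𝓝 p := by
    apply hT.continuousAt.preimage_mem_nhds
    rw [hTp]; exact ball_mem_nhds p hr
  obtain ⟨r1, hr1, hr1s⟩ := Metric.mem_nhds_iff.1 (Filter.inter_mem hTc (ball_mem_nhds p hr))
  set φ : E → ℝ := fun x => √(V x - V p) with hφ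
  set C := 4 / √ν with hC
  have hsν : 0 < √ν := Real.sqrt_pos.2 hν
  have hCpos : 0 < C := by positivity
  have step : ∀ y ∈ ball p r1, ‖T y - y‖ ≤ C * (φ y - φ (T y)) := by
    intro y hy
    have hyN : y ∈ N := (hrO (hr1s hy).2).2
    have hTyN : T y ∈ N := (hrO (hr1s hy).1).2
    have a0 : 0 ≤ φ y := Real.sqrt_nonneg _
    have b0 : 0 ≤ φ (T y) := Real.sqrt_nonneg _
    have a2 : φ y ^ 2 = V y - V p := Real.sq_sqrt (by linarith [hmin y hyN])
    have b2 : φ (T y) ^ 2 = V (T y) - V p := Real.sq_sqrt (by linarith [hmin _ hTyN])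
    have h1 := hTV y
    have hq : 0 ≤ η y * ‖G y‖^2/2 := by have := hη y; positivity
    have hab : φ (T y) ≤ φ y := Real.sqrt_le_sqrt (by linarith)
    rw [hTn]
    rcases eq_or_lt_of_le (norm_nonneg (G y)) with h0 | hpos
    · rw [← h0, mul_zero]; exact mul_nonneg hCpos.le (by linarith)
    · have h2 : √ν * φ y ≤ ‖G y‖ := by
        apply (sq_le_sq₀ (by positivity) (norm_nonneg _)).1
        rw [mul_pow, Real.sq_sqrt hν.le, a2]
        exact hPL y hyN
      have h3 : η y * ‖G y‖^2/2 ≤ (φ y - φ (T y)) * (2 * φ y) := by nlinarith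
      have h4 : √ν * (η y * ‖G y‖) ≤ 4 * (φ y - φ (T y)) := by
        have h5 : (φ y - φ (T y)) * (2 * (√ν * φ y)) ≤ (φ y - φ (T y)) * (2 * ‖G y‖) := by
          have : 0 ≤ φ y - φ (T y) := by linarith
          gcongr
        have h6 : √ν * (η y * ‖G y‖^2/2) ≤ √ν * ((φ y - φ (T y)) * (2 * φ y)) := by gcongr
        have h7 : (√ν * (η y * ‖G y‖)) * ‖G y‖ ≤ (4 * (φ y - φ (T y))) * ‖G y‖ := by
          nlinarith
        exact le_of_mul_le_mul_right h7 hpos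
      rw [hC, div_mul_eq_mul_div, le_div_iff₀ hsν]
      linarith
  have hφc : Continuous φ := by simp only [hφ]; fun_prop
  have e1 : ∀ᶠ x in 𝓝 p, C * φ x < r1/2 := by
    have : ContinuousAt (fun x => C * φ x) p := by fun_prop
    apply this.eventually_lt_const
    simp [hφ, hr1]
  filter_upwards [e1, ball_mem_nhds p (half_pos hr1)] with x hx1 hx2
  have hx2' : ‖x - p‖ < r1/2 := by simpa [dist_eq_norm] using hx2
  have main : ∀ n, ‖T^[n] x - x‖ ≤ C * (φ x - φ (T^[n] x)) ∧ T^[n] x ∈ ball p r1 := by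
    intro n
    have fin : ∀ z, ‖z - x‖ ≤ C * (φ x - φ z) → z ∈ ball p r1 := by
      intro z hz
      have : 0 ≤ C * φ z := mul_nonneg hCpos.le (Real.sqrt_nonneg _)
      rw [mem_ball, dist_eq_norm]
      calc ‖z - p‖ = ‖(z - x) + (x - p)‖ := by congr 1; abel
        _ ≤ ‖z - x‖ + ‖x - p‖ := norm_add_le _ _
        _ < r1 := by nlinarith
    induction n with
    | zero => simp; exact (by linarith [norm_nonneg (x-p), dist_eq_norm x p] : dist x p < r1)
    | succ n ih =>
      have h : ‖T^[n+1] x - x‖ ≤ C * (φ x - φ (T^[n+1] x)) := by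
        rw [Function.iterate_succ_apply']
        have h1 := step _ ih.2
        calc ‖T (T^[n] x) - x‖ = ‖(T (T^[n] x) - T^[n] x) + (T^[n] x - x)‖ := by congr 1; abel
          _ ≤ ‖T (T^[n] x) - T^[n] x‖ + ‖T^[n] x - x‖ := norm_add_le _ _
          _ ≤ _ := by nlinarith [ih.1]
      exact ⟨h, fin _ h⟩
  intro n
  exact (hrO (hr1s (main n).2).2).1
end Descent

section Conn
variable {E : Type*} [NormedAddCommGroup E] [InnerProductSpace ℝ E] [FiniteDimensional ℝ E]

lemma limit_aux {V : E → ℝ} {G : E → E} (hVc : Continuous V)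
    (hco : Tendsto V (cocompact E) atTop)
    (T : E → E) (η : E → ℝ) (hT : Continuous T) (hη : ∀ x, 0 < η x)
    (hT0 : ∀ x, G x = 0 → T x = x) (hTG : ∀ x, G (T x) = 0 → G x = 0)
    (hTV : ∀ x, V (T x) ≤ V x - η x * ‖G x‖ ^ 2 / 2)
    (S M : Set E) (hcrit : ∀ x, G x = 0 → x ∈ S ∨ x ∈ M) (hMG : ∀ x ∈ M, G x = 0)
    (hMmax : ∀ z ∈ M, ∀ᶠ y in 𝓝 z, V y ≤ V z ∧ (G y = 0 → y = z))
    (x : E) (hx : x ∉ M) : ∃ z ∈ S, MapClusterPt z atTop (fun n => T^[n] x) := by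
  have hq : ∀ y, 0 ≤ η y * ‖G y‖^2/2 := fun y => by have := hη y; positivity
  have hdec : ∀ y, V (T y) ≤ V y := fun y => by linarith [hTV y, hq y]
  have hG0 : ∀ y, V y ≤ V (T y) → G y = 0 := by
    intro y hy
    have h1 := hTV y
    have h2 : η y * ‖G y‖^2 ≤ 0 := by linarith
    have h3 : ‖G y‖^2 ≤ 0 := by
      by_contra h
      push Not at h
      nlinarith [mul_pos (hη y) h]
    have : ‖G y‖ = 0 := by nlinarith [norm_nonneg (G y)]
    simpa using this
  have hnM : ∀ n, T^[n] x ∉ M := by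
    intro n
    induction n with
    | zero => exact hx
    | succ n ih =>
      rw [Function.iterate_succ_apply']
      intro h
      have h1 := hTG _ (hMG _ h)
      rw [hT0 _ h1] at h
      exact ih h
  have hanti : Antitone (fun n => V (T^[n] x)) := by
    apply antitone_nat_of_succ_le
    intro n
    rw [Function.iterate_succ_apply']
    exact hdec _
  obtain ⟨Kc, hKc, hKs⟩ := Filter.mem_cocompact.1 (hco.eventually_gt_atTop (V x))
  have hin : ∀ n, T^[n] x ∈ Kc := by
    intro n
    by_contra h
    have h1 : V x < V (T^[n] x) := hKs h
    have h2 : V (T^[n] x) ≤ V x := hanti (Nat.zero_le n)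
    linarith
  obtain ⟨z, hz, a, ha, hlim⟩ := hKc.tendsto_subseq hin
  have hlimV : Tendsto (fun n => V (T^[a n] x)) atTop (𝓝 (V z)) :=
    (hVc.tendsto z).comp hlim
  have hge : ∀ n, V z ≤ V (T^[n] x) := by
    intro n
    apply le_of_tendsto hlimV
    filter_upwards [Filter.eventually_ge_atTop n] with m hm
    exact hanti (hm.trans (ha.id_le m))
  have hlimV' : Tendsto (fun n => V (T (T^[a n] x))) atTop (𝓝 (V (T z))) :=
    ((hVc.comp hT).tendsto z).comp hlim
  have hzG : G z = 0 := by
    apply hG0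
    apply ge_of_tendsto hlimV'
    filter_upwards with n
    rw [← Function.iterate_succ_apply' T]
    exact hge _
  have hzcl : MapClusterPt z atTop (fun n => T^[n] x) :=
    MapClusterPt.of_comp ha.tendsto_atTop hlim.mapClusterPt
  rcases hcrit z hzG with h | h
  · exact ⟨z, h, hzcl⟩
  · exfalso
    obtain ⟨n, hn1, hn2⟩ := (hzcl.frequently (hMmax z h)).exists
    have : G (T^[n] x) = 0 := by
      apply hG0
      rw [← Function.iterate_succ_apply' T n x]
      exact hn1.trans (hge _)
    apply hnM n
    rw [hn2 this]; exact h

lemma conn_aux (hrank : 1 < Module.rank ℝ E) {V : E → ℝ} {G : E → E} (hVc : Continuous V)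
    (hco : Tendsto V (cocompact E) atTop)
    (T : E → E) (η : E → ℝ) (hT : Continuous T) (hη : ∀ x, 0 < η x)
    (hT0 : ∀ x, G x = 0 → T x = x) (hTG : ∀ x, G (T x) = 0 → G x = 0)
    (hTV : ∀ x, V (T x) ≤ V x - η x * ‖G x‖ ^ 2 / 2)
    (S M : Set E) (hcrit : ∀ x, G x = 0 → x ∈ S ∨ x ∈ M) (hMG : ∀ x ∈ M, G x = 0)
    (hSG : ∀ x ∈ S, G x = 0) (hSM : ∀ x ∈ S, x ∉ M) (hMc : M.Countable)
    (hMmax : ∀ z ∈ M, ∀ᶠ y in 𝓝 z, V y ≤ V z ∧ (G y = 0 → y = z))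
    (hstab : ∀ p ∈ S, ∀ O ∈ 𝓝 p, ∀ᶠ x in 𝓝 p, ∀ n : ℕ, T^[n] x ∈ O)
    (κ : E → ℕ) (hκ : ∀ p ∈ S, ∀ᶠ y in 𝓝 p, y ∈ S → κ y = κ p)
    (p q : E) (hp : p ∈ S) (hq : q ∈ S) : κ p = κ q := by
  classical
  have hl := limit_aux hVc hco T η hT hη hT0 hTG hTV S M hcrit hMG hMmax
  choose! z hzS hzc using hl
  have hfix : ∀ p ∈ S, z p = p := by
    intro p hp
    have h := hzc p (hSM p hp)
    have hc : (fun n => T^[n] p) = fun _ => p := by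
      funext n
      exact Function.iterate_fixed (hT0 p (hSG p hp)) n
    rw [hc] at h
    by_contra hne
    obtain ⟨n, hn⟩ := (h.frequently (isOpen_compl_singleton.mem_nhds hne :
      {p}ᶜ ∈ 𝓝 (z p))).exists
    exact hn rfl
  have hcont : ContinuousOn (fun x => κ (z x)) Mᶜ := by
    intro x hx
    suffices hev : (fun x => κ (z x)) =ᶠ[𝓝[Mᶜ] x] fun _ => κ (z x) from
      (continuousWithinAt_const (b := κ (z x))).congr_of_eventuallyEq hev rfl
    obtain ⟨O, ⟨hO, hOc⟩, hOs⟩ := (closed_nhds_basis (z x)).mem_iff.1 (hκ _ (hzS x hx))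
    have hst := hstab _ (hzS x hx) O hO
    obtain ⟨n, hn⟩ := ((hzc x hx).frequently hst.eventually_nhds).exists
    have hev : ∀ᶠ y in 𝓝 x, ∀ m : ℕ, T^[m] (T^[n] y) ∈ O :=
      (hT.iterate n).continuousAt.eventually hn
    filter_upwards [mem_nhdsWithin_of_mem_nhds hev, self_mem_nhdsWithin] with y hy hyM
    apply hOs (a := z y) _ (hzS y hyM)
    by_contra hne
    have h1 := (hzc y hyM).frequently (hOc.isOpen_compl.mem_nhds hne)
    obtain ⟨m, hm, hnm⟩ := (h1.and_eventually (Filter.eventually_ge_atTop n)).exists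
    apply hm
    have := hy (m - n)
    rwa [← Function.iterate_add_apply, Nat.sub_add_cancel hnm] at this
  have hpc := (hMc.isPathConnected_compl_of_one_lt_rank hrank).isConnected.isPreconnected
  have := hpc.constant hcont (hSM p hp) (hSM q hq)
  simpa [hfix p hp, hfix q hq] using this

lemma max_aux {V : E → ℝ} {G : E → E} (hG : ∀ x, HasGradientAt V (G x) x)
    (hGC : ContDiff ℝ 1 G) {z : E} (hz : G z = 0)
    (hneg : ∀ v, v ≠ 0 → inner ℝ (fderiv ℝ G z v) v < 0) :
    ∀ᶠ y in 𝓝 z, V y ≤ V z ∧ (G y = 0 → y = z) := by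
  set H := fderiv ℝ G z with hH
  have hD : HasFDerivAt G H z := (hGC.differentiable (by norm_num) z).hasFDerivAt
  -- uniform negativity
  obtain ⟨c, hc, hcH⟩ : ∃ c > 0, ∀ v, inner ℝ (H v) v ≤ - c * ‖v‖^2 := by
    have hcomp : IsCompact (sphere (0:E) 1) := isCompact_sphere 0 1
    rcases (sphere (0:E) 1).eq_empty_or_nonempty with he | hne
    · refine ⟨1, one_pos, fun v => ?_⟩
      have : v = 0 := by
        by_contra hv
        have : (‖v‖⁻¹ • v) ∈ sphere (0:E) 1 := by
          simp [norm_smul, hv]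
        rw [he] at this; exact this
      simp [this]
    · have hcont : Continuous (fun v => inner ℝ (H v) v) := by fun_prop
      obtain ⟨u, hu, humax⟩ := hcomp.exists_isMaxOn hne hcont.continuousOn
      have hu0 : u ≠ 0 := by
        rintro rfl
        simp at hu
      refine ⟨- inner ℝ (H u) u, by linarith [hneg u hu0], fun v => ?_⟩
      by_cases hv : v = 0
      · simp [hv]
      have hvn : 0 < ‖v‖ := norm_pos_iff.2 hv
      have hs : (‖v‖⁻¹ • v) ∈ sphere (0:E) 1 := by simp [norm_smul, hv]
      have h1 : inner ℝ (H (‖v‖⁻¹ • v)) (‖v‖⁻¹ • v) ≤ inner ℝ (H u) u := humax hs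
      rw [map_smul, inner_smul_left, inner_smul_right] at h1
      simp only [conj_trivial] at h1
      have h2 : inner ℝ (H v) v = ‖v‖^2 * (‖v‖⁻¹ * (‖v‖⁻¹ * inner ℝ (H v) v)) := by
        field_simp
      rw [h2]
      nlinarith [sq_nonneg ‖v‖]
  have hlo := hD.isLittleO.def (half_pos hc)
  obtain ⟨r, hr, hball⟩ := Metric.eventually_nhds_iff_ball.1 hlo
  have hineq : ∀ y ∈ ball z r, inner ℝ (G y) (y - z) ≤ - (c/2) * ‖y - z‖^2 := by
    intro y hy
    have h1 := hball y hy
    rw [hz, sub_zero] at h1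
    set e := G y - H (y - z) with he
    have h2 : G y = H (y - z) + e := by rw [he]; abel
    rw [h2, inner_add_left]
    have h3 := hcH (y - z)
    have h4 := abs_le.1 (abs_real_inner_le_norm e (y - z))
    have h5 : ‖e‖ * ‖y - z‖ ≤ (c/2 * ‖y - z‖) * ‖y - z‖ := by gcongr
    nlinarith
  filter_upwards [ball_mem_nhds z hr] with y hy
  constructor
  · have h := mvt_le_aux (f := fun s : ℝ => V (z + s • (y - z)))
      (f' := fun s => inner ℝ (G (z + s • (y - z))) (y - z)) (a := 1) (C := 0)
      zero_le_one
      (fun s _ => grad_path_aux (γ := fun s : ℝ => z + s • (y - z)) (hG _)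
        (by simpa using ((hasDerivAt_id s).smul_const (y - z)).const_add z))
      (fun s hs => by
        rcases eq_or_lt_of_le hs.1 with h0 | h0
        · simp [← h0, hz]
        have hin : z + s • (y - z) ∈ ball z r := by
          rw [mem_ball, dist_eq_norm] at hy ⊢
          rw [add_sub_cancel_left, norm_smul, Real.norm_of_nonneg hs.1]
          nlinarith [norm_nonneg (y - z), hs.2]
        have h1 := hineq _ hin
        rw [add_sub_cancel_left, inner_smul_right] at h1
        have h2 : s * inner ℝ (G (z + s • (y - z))) (y - z) ≤ 0 := by
          have : 0 ≤ c/2 * ‖s • (y - z)‖^2 := by positivity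
          linarith
        exact nonpos_of_mul_nonpos_right h2 h0)
    simp only [zero_smul, one_smul, add_zero, add_sub_cancel] at h
    linarith
  · intro hGy
    have h1 := hineq y hy
    rw [hGy, inner_zero_left] at h1
    have h2 : ‖y - z‖^2 ≤ 0 := by
      by_contra h
      push Not at h
      nlinarith
    have : ‖y - z‖ = 0 := by nlinarith [norm_nonneg (y - z)]
    rwa [norm_eq_zero, sub_eq_zero] at this

lemma countable_aux (M : Set E) (h : ∀ z ∈ M, ∀ᶠ y in 𝓝 z, y ∈ M → y = z) : M.Countable := by
  have : DiscreteTopology M := by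
    rw [discreteTopology_iff_isOpen_singleton]
    rintro ⟨z, hz⟩
    rw [isOpen_singleton_iff_nhds_eq_pure, ← Filter.principal_singleton]
    apply le_antisymm
    · rw [Filter.le_principal_iff, nhds_subtype_eq_comap]
      refine ⟨_, h z hz, ?_⟩
      rintro ⟨y, hy⟩ hy'
      exact Subtype.ext (hy' hy)
    · rw [Filter.principal_singleton]; exact pure_le_nhds _
  have : Countable M := countable_of_Lindelof_of_discrete
  exact this

end Conn

lemma flatten_aux {d : ℕ} (K : Submodule ℝ (Euc d)) (k : ℕ) (hk : Module.finrank ℝ K = k) :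
    ∃ L : Euc d ≃L[ℝ] Euc d, ∀ x, x ∈ K ↔ ∀ i : Fin d, k ≤ (i : ℕ) → L x i = 0 := by
  have hkd : k ≤ d := by
    have := Submodule.finrank_le K
    simp at this; omega
  let b := stdOrthonormalBasis ℝ K
  let ι : Fin (Module.finrank ℝ K) → Fin d := Fin.castLE (by omega)
  let b0 := EuclideanSpace.basisFun (Fin d) ℝ
  have hon : Orthonormal ℝ (b0 ∘ ι) := b0.orthonormal.comp ι (Fin.castLE_injective _)
  let A : K →ₗᵢ[ℝ] Euc d := LinearMap.isometryOfOrthonormal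
    (b.toBasis.constr ℝ (b0 ∘ ι)) (v := b.toBasis) (by simp)
    (by
      have : (b.toBasis.constr ℝ (b0 ∘ ι)) ∘ b.toBasis = b0 ∘ ι := by
        funext i; exact b.toBasis.constr_basis ℝ (b0 ∘ ι) i
      rw [this]; exact hon)
  have hA : ∀ i, A (b i) = b0 (ι i) := by
    intro i
    have := b.toBasis.constr_basis ℝ (b0 ∘ ι) i
    rw [OrthonormalBasis.coe_toBasis] at this
    exact this
  let L := A.extend.toLinearIsometryEquiv rfl
  have hL : ∀ x : K, L x = A x := fun x => A.extend_apply x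
  have hfw : ∀ x : K, ∀ i : Fin d, k ≤ (i:ℕ) → A x i = 0 := by
    intro x i hi
    rw [← b.sum_repr x, map_sum]
    simp only [map_smul, hA, WithLp.ofLp_sum, Finset.sum_apply]
    apply Finset.sum_eq_zero
    intro j _
    have : i ≠ ι j := by
      intro h
      have h1 : (i:ℕ) = j := by rw [h]; rfl
      have := j.2
      omega
    simp [b0, this]
  refine ⟨L.toContinuousLinearEquiv, fun x => ⟨fun hx i hi => ?_, fun hx => ?_⟩⟩
  · have := hfw ⟨x, hx⟩ i hi
    rw [← hL] at this
    exact this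
  · have h1 : L x = A (∑ j, (L x (ι j)) • b j) := by
      rw [map_sum]
      simp only [map_smul, hA]
      ext i
      simp only [WithLp.ofLp_sum, Finset.sum_apply]
      by_cases hi : k ≤ (i:ℕ)
      · rw [Finset.sum_eq_zero]
        · exact hx i hi
        · intro j _
          have : i ≠ ι j := by
            intro h
            have h1 : (i:ℕ) = j := by rw [h]; rfl
            have := j.2
            omega
          simp [b0, this]
      · have hi' : (i:ℕ) < Module.finrank ℝ K := by omega
        rw [Finset.sum_eq_single ⟨i, hi'⟩]
        · have : ι ⟨i, hi'⟩ = i := rfl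
          simp [b0, this]
        · intro j _ hj
          have : i ≠ ι j := by
            intro h
            apply hj
            ext
            simp [h, ι]
          simp [b0, this]
        · simp
    rw [← hL] at h1
    have := L.injective h1
    rw [this]
    exact Subtype.property _

/-- under Assumptions 1–3 and `d ≥ 2`, the set `S` of local minima is a
`C²` embedded submanifold of `ℝ^d` without boundary: there is `k ≤ d - 1` such that
around every point of `S` there is a `C²` chart flattening `S` onto `ℝ^k × {0}`. -/
theorem localMinSet_is_C2_submanifold
    {d : ℕ} (hd : 2 ≤ d) (V : Euc d → ℝ)
    (hV : ContDiff ℝ 2 V) (hnc : ∃ x y : Euc d, V x ≠ V y)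
    (ν : ℝ) (𝒩 : Set (Euc d) → Set (Euc d))
    (h1 : Assumption1 V ν 𝒩) (h2 : Assumption2 V 𝒩)
    (R₀ ν_eb C_g : ℝ) (h3 : Assumption3 V R₀ ν_eb C_g) :
    ∃ k : ℕ, k ≤ d - 1 ∧
      ∀ p ∈ localMinSet V,
        ∃ (U W : Set (Euc d)) (φ ψ : Euc d → Euc d),
          p ∈ U ∧ IsOpen U ∧ IsOpen W ∧
          ContDiffOn ℝ 2 φ U ∧ ContDiffOn ℝ 2 ψ W ∧
          (∀ x ∈ U, ψ (φ x) = x) ∧ (∀ y ∈ W, φ (ψ y) = y) ∧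
          φ '' U = W ∧
          φ '' (localMinSet V ∩ U) = W ∩ {x : Euc d | ∀ i : Fin d, k ≤ (i : ℕ) → x i = 0} := by
  obtain ⟨hν, h1⟩ := h1
  obtain ⟨_, _, _, _, hco, _⟩ := h3
  have hVc : Continuous V := hV.continuous
  set G : Euc d → Euc d := gradient V with hGdef
  have hG : ∀ x, HasGradientAt V (G x) x := fun x =>
    (hV.differentiable (by norm_num) x).hasGradientAt
  have hGC : ContDiff ℝ 1 G :=
    (InnerProductSpace.toDual ℝ (Euc d)).symm.contDiff.comp
      (hV.fderiv_right (m := 1) (by norm_num))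
  set S := localMinSet V with hS
  have hSG : ∀ x ∈ S, G x = 0 := by
    intro x hx
    have h : fderiv ℝ V x = 0 := IsLocalMin.fderiv_eq_zero hx
    simp [hGdef, gradient, h]
  have hbdd : ∃ m, ∀ y, m ≤ V y := by
    obtain ⟨x, hx⟩ := hVc.exists_forall_le hco
    exact ⟨V x, hx⟩
  obtain ⟨m, hm⟩ := hbdd
  have hloc : ∀ p ∈ S, ∃ N : Set (Euc d), N = 𝒩 (connectedComponentIn S p) ∧ IsOpen N ∧ p ∈ N ∧
      ContDiffOn ℝ 3 V N ∧ (∀ y ∈ N, ν * (V y - V p) ≤ ‖G y‖ ^ 2) ∧ (∀ y ∈ N, V p ≤ V y) := by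
    intro p hp
    obtain ⟨ho, hsub, hC, hPL⟩ := h1 p hp
    have hpN := hsub (mem_connectedComponentIn hp)
    have hb : BddBelow (V '' 𝒩 (connectedComponentIn S p)) :=
      ⟨m, by rintro _ ⟨y, _, rfl⟩; exact hm y⟩
    have hle : ∀ y ∈ 𝒩 (connectedComponentIn S p),
        sInf (V '' 𝒩 (connectedComponentIn S p)) ≤ V y := fun y hy => csInf_le hb ⟨y, hy, rfl⟩
    have h0 := hPL p hpN
    rw [hSG p hp, norm_zero] at h0
    have heq : sInf (V '' 𝒩 (connectedComponentIn S p)) = V p := by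
      apply le_antisymm (hle p hpN)
      by_contra hlt
      push Not at hlt
      nlinarith [mul_pos hν (sub_pos.2 hlt)]
    rw [heq] at hPL hle
    exact ⟨_, rfl, ho, hpN, hC, hPL, hle⟩
  have hmem : ∀ p ∈ S, ∀ N : Set (Euc d), IsOpen N →
      (∀ y ∈ N, ν * (V y - V p) ≤ ‖G y‖ ^ 2) → (∀ y ∈ N, V p ≤ V y) →
      ∀ x ∈ N, G x = 0 → x ∈ S := by
    intro p hp N hN hPL hmin x hx hGx
    have h := hPL x hx
    rw [hGx, norm_zero] at h
    have hxp : V x ≤ V p := by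
      by_contra hlt
      push Not at hlt
      nlinarith [mul_pos hν (sub_pos.2 hlt)]
    change IsLocalMin V x
    filter_upwards [hN.mem_nhds hx] with y hy
    exact hxp.trans (hmin y hy)
  set M : Set (Euc d) := {x | G x = 0 ∧ x ∉ S} with hM
  have hMmax : ∀ z ∈ M, ∀ᶠ y in 𝓝 z, V y ≤ V z ∧ (G y = 0 → y = z) := by
    rintro z ⟨hz, hzS⟩
    apply max_aux hG hGC hz
    intro v hv
    refine h2 z ?_ hz v hv
    intro hzN
    simp only [NSet, mem_iUnion] at hzN
    obtain ⟨p, hp, hzp⟩ := hzN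
    obtain ⟨N, hNeq, ho, hpN, hC, hPL, hmin⟩ := hloc p hp
    rw [← hS, ← hNeq] at hzp
    exact hzS (hmem p hp N ho hPL hmin z hzp hz)
  have hMc : M.Countable := by
    apply countable_aux
    intro z hz
    filter_upwards [hMmax z hz] with y hy hyM
    exact hy.2 hyM.1
  have hrank : 1 < Module.rank ℝ (Euc d) := by
    rw [← Module.finrank_eq_rank, finrank_euclideanSpace_fin]
    exact_mod_cast hd
  have hchart : ∀ p ∈ S, ∃ (U W : Set (Euc d)) (φ ψ : Euc d → Euc d),
      p ∈ U ∧ IsOpen U ∧ IsOpen W ∧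
      ContDiffOn ℝ 2 φ U ∧ ContDiffOn ℝ 2 ψ W ∧
      (∀ x ∈ U, ψ (φ x) = x) ∧ (∀ y ∈ W, φ (ψ y) = y) ∧ φ '' U = W ∧
      (∀ x ∈ U, x ∈ S ↔ φ x ∈ (fderiv ℝ G p).ker) ∧
      (∀ x ∈ U, x ∈ S → Module.finrank ℝ (fderiv ℝ G x).ker
        = Module.finrank ℝ (fderiv ℝ G p).ker) := by
    intro p hp
    obtain ⟨N, hNeq, ho, hpN, hC, hPL, hmin⟩ := hloc p hp
    have hGC2 : ∀ x ∈ N, ContDiffAt ℝ 2 G x := by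
      intro x hx
      have h := (hC.contDiffAt (ho.mem_nhds hx)).fderiv_right (m := 2) (by norm_num)
      exact (InnerProductSpace.toDual ℝ (Euc d)).symm.contDiff.contDiffAt.comp x h
    have hsymm : ∀ v w, inner ℝ (fderiv ℝ G p v) w = inner ℝ v (fderiv ℝ G p w) := by
      have hin : ∀ v w, inner ℝ (fderiv ℝ G p v) w = fderiv ℝ (fderiv ℝ V) p v w := by
        intro v w
        have hd2 : HasFDerivAt (fderiv ℝ V) (fderiv ℝ (fderiv ℝ V) p) p :=
          (((hV.fderiv_right (m := 1) (by norm_num)).differentiable (by norm_num)) p).hasFDerivAt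
        have hd3 : HasFDerivAt G (fderiv ℝ G p) p :=
          (hGC.differentiable (by norm_num) p).hasFDerivAt
        have e1 := hd3.inner ℝ (hasFDerivAt_const w p)
        have e2 := hd2.clm_apply (hasFDerivAt_const w p)
        have e3 : (fun x => inner ℝ (G x) w) = fun x => fderiv ℝ V x w := by
          funext x
          exact inner_gradient_left
        rw [e3] at e1
        have := DFunLike.congr_fun (e1.unique e2) v
        simpa using this
      have hs : IsSymmSndFDerivAt ℝ V p := hV.contDiffAt.isSymmSndFDerivAt (by simp)
      intro v w
      rw [hin, real_inner_comm, hin, hs.eq]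
    obtain ⟨U, W, φ, ψ, a1, a2, a3, a4, a5, a6, a7, a8, a9, a10, a11⟩ :=
      chart_aux hν hG ho hpN hGC2 hPL hmin (hSG p hp) hsymm
    have hiff : ∀ x ∈ U, x ∈ S ↔ G x = 0 := fun x hx =>
      ⟨hSG x, hmem p hp N ho hPL hmin x (a4 hx)⟩
    refine ⟨U, W, φ, ψ, a1, a2, a3, a5, a6, a7, a8, a9, ?_, ?_⟩
    · intro x hx
      rw [hiff x hx, a10 x hx]
    · intro x hx hxS
      exact a11 x hx (hSG x hxS)
  obtain ⟨T, η, hT, hη, hT0, hTG, hTn, hTV⟩ := exists_descent_aux hG hGC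
  have hconst : ∀ p ∈ S, ∀ q ∈ S, Module.finrank ℝ (fderiv ℝ G p).ker
      = Module.finrank ℝ (fderiv ℝ G q).ker := by
    intro p hp q hq
    refine conn_aux hrank hVc hco T η hT hη hT0 hTG hTV S M ?_ (fun x hx => hx.1) hSG
      (fun x hx hxM => hxM.2 hx) hMc hMmax ?_ (fun x => Module.finrank ℝ (fderiv ℝ G x).ker) ?_
      p q hp hq
    · intro x hx
      by_cases h : x ∈ S
      · exact Or.inl h
      · exact Or.inr ⟨hx, h⟩
    · intro p hp O hO
      obtain ⟨N, hNeq, ho, hpN, hC, hPL, hmin⟩ := hloc p hp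
      exact stable_aux hν hVc ho hpN hPL hmin T η hT hη (hT0 p (hSG p hp)) hTn hTV O hO
    · intro p hp
      obtain ⟨U, W, φ, ψ, a1, a2, a3, a5, a6, a7, a8, a9, a10, a11⟩ := hchart p hp
      filter_upwards [a2.mem_nhds a1] with y hy hyS
      exact a11 y hy hyS
  rcases S.eq_empty_or_nonempty with hemp | ⟨p0, hp0⟩
  · refine ⟨0, Nat.zero_le _, fun p hp => ?_⟩
    rw [hemp] at hp
    exact absurd hp (notMem_empty p)
  refine ⟨Module.finrank ℝ (fderiv ℝ G p0).ker, ?_, ?_⟩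
  · by_contra hk
    have hle := Submodule.finrank_le (fderiv ℝ G p0).ker
    have hfd : Module.finrank ℝ (Euc d) = d := finrank_euclideanSpace_fin
    have hkd : Module.finrank ℝ (fderiv ℝ G p0).ker = d := by omega
    have hSo : IsOpen S := by
      rw [isOpen_iff_mem_nhds]
      intro p hp
      obtain ⟨U, W, φ, ψ, a1, a2, a3, a5, a6, a7, a8, a9, a10, a11⟩ := hchart p hp
      have htop : (fderiv ℝ G p).ker = ⊤ := by
        apply Submodule.eq_top_of_finrank_eq
        rw [hconst p hp p0 hp0, hkd, hfd]
      filter_upwards [a2.mem_nhds a1] with y hy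
      rw [a10 y hy, htop]
      exact Submodule.mem_top
    have hpc := (hMc.isPathConnected_compl_of_one_lt_rank hrank).isConnected.isPreconnected
    have hall : ∀ x, G x = 0 := by
      intro x
      by_contra hx
      have ho2 : IsOpen {x | G x ≠ 0} := isOpen_ne_fun hGC.continuous continuous_const
      obtain ⟨y, _, hy1, hy2⟩ := hpc S {x | G x ≠ 0} hSo ho2
        (fun y hy => by
          by_cases h : G y = 0
          · left
            by_contra hyS
            exact hy ⟨h, hyS⟩
          · exact Or.inr h)
        ⟨p0, fun h => h.2 hp0, hp0⟩ ⟨x, fun h => hx h.1, hx⟩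
      exact hy2 (hSG y hy1)
    obtain ⟨x, y, hxy⟩ := hnc
    apply hxy
    apply is_const_of_fderiv_eq_zero (𝕜 := ℝ) (hV.differentiable (by norm_num))
    intro z
    have := hall z
    rw [← toDual_gradient, ← hGdef, this, map_zero]
  · intro p hp
    obtain ⟨U, W, φ, ψ, a1, a2, a3, a5, a6, a7, a8, a9, a10, a11⟩ := hchart p hp
    obtain ⟨L, hL⟩ := flatten_aux (fderiv ℝ G p).ker _ (hconst p hp p0 hp0)
    refine ⟨U, L.symm ⁻¹' W, L ∘ φ, ψ ∘ L.symm, a1, a2, a3.preimage L.symm.continuous,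
      L.contDiff.comp_contDiffOn a5, ?_, ?_, ?_, ?_, ?_⟩
    · exact a6.comp L.symm.contDiff.contDiffOn (fun y hy => hy)
    · intro x hx
      simp [a7 x hx]
    · intro y hy
      simp [a8 _ hy]
    · rw [image_comp, a9, L.image_eq_preimage_symm]
    · ext y
      constructor
      · rintro ⟨x, ⟨hxS, hxU⟩, rfl⟩
        refine ⟨?_, ?_⟩
        · change L.symm (L (φ x)) ∈ W
          rw [L.symm_apply_apply, ← a9]
          exact mem_image_of_mem φ hxU
        · exact (hL (φ x)).1 ((a10 x hxU).1 hxS)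
      · rintro ⟨hyW, hy⟩
        have hyW' : L.symm y ∈ φ '' U := by rw [a9]; exact hyW
        obtain ⟨x, hxU, hx⟩ := hyW'
        have hyx : L (φ x) = y := by rw [hx, L.apply_symm_apply]
        refine ⟨x, ⟨?_, hxU⟩, hyx⟩
        rw [a10 x hxU, hL, hyx]
        exact hy
end
end

section
/- Let V : ℝ^d → ℝ satisfy Assumptions 1–3, let S be its set of local minima with PL neighborhood N(S), let X be its set of local maxima, and let R₁ > 0 be as in the context (with N(X) = {x : dist(x,X) ≤ R₁}, taken empty if X = ∅). Then there exists a constant g₀ > 0 such that ‖∇V(x)‖ ≥ g₀ for every x ∉ N(X) ∪ N(S). -/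
open MeasureTheory Real Filter Metric Set
open scoped RealInnerProductSpace ENNReal Topology

noncomputable section

variable {d : ℕ}

/-- The closed `R₁`-neighborhood of the set of local maxima (empty if there are no
local maxima). -/
def maxNbhd (V : Euc d → ℝ) (R₁ : ℝ) : Set (Euc d) :=
  {y | (localMaxSet V).Nonempty ∧ infDist y (localMaxSet V) ≤ R₁}

theorem aux_contgrad {d : ℕ} (V : Euc d → ℝ) (hV : ContDiff ℝ 2 V) :
    ContDiff ℝ 1 (gradient V) := by
  have h : ContDiff ℝ 1 (fderiv ℝ V) := hV.fderiv_right (by norm_num)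
  exact (InnerProductSpace.toDual ℝ (Euc d)).symm.contDiff.comp h

theorem aux_localMax {d : ℕ} (V : Euc d → ℝ) (hV : ContDiff ℝ 2 V) (x : Euc d)
    (hg : gradient V x = 0) (hH : ∀ v : Euc d, v ≠ 0 → hessQ V x v < 0) :
    IsLocalMax V x := by
  have hc : ∃ c > (0 : ℝ), ∀ v : Euc d, hessQ V x v ≤ -c * ‖v‖ ^ 2 := by
    by_cases hne : (sphere (0 : Euc d) 1).Nonempty
    · have hcont : Continuous (fun v => hessQ V x v) := by
        unfold hessQ; fun_prop
      obtain ⟨u, hu, hmax⟩ := (isCompact_sphere (0 : Euc d) 1).exists_isMaxOn hne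
        hcont.continuousOn
      have hu1 : ‖u‖ = 1 := by simpa using hu
      refine ⟨-hessQ V x u, ?_, ?_⟩
      · have := hH u (by rintro rfl; simp at hu1)
        linarith
      · intro v
        by_cases hv : v = 0
        · subst hv; simp [hessQ]
        have hv' : 0 < ‖v‖ := norm_pos_iff.mpr hv
        have h1 : hessQ V x (‖v‖⁻¹ • v) ≤ hessQ V x u := by
          apply hmax
          simp [norm_smul, hv'.ne']
        have h2 : hessQ V x (‖v‖⁻¹ • v) = (‖v‖⁻¹) ^ 2 * hessQ V x v := by
          simp only [hessQ, map_smul, real_inner_smul_left, real_inner_smul_right]; ring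
        rw [h2] at h1
        have h3 : hessQ V x v = ‖v‖ ^ 2 * ((‖v‖⁻¹) ^ 2 * hessQ V x v) := by
          field_simp
        rw [h3]
        nlinarith [sq_nonneg ‖v‖]
    · refine ⟨1, one_pos, fun v => ?_⟩
      by_cases hv : v = 0
      · subst hv; simp [hessQ]
      · exact absurd ⟨‖v‖⁻¹ • v, by simp [norm_smul, hv]⟩ hne
  obtain ⟨c, hc0, hc⟩ := hc
  have hd : HasFDerivAt (gradient V) (fderiv ℝ (gradient V) x) x :=
    ((aux_contgrad V hV).differentiable (by norm_num) x).hasFDerivAt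
  have hev := (hasFDerivAt_iff_isLittleO.mp hd).def hc0
  obtain ⟨δ, hδ, hball⟩ := Metric.eventually_nhds_iff.mp hev
  refine Metric.eventually_nhds_iff.mpr ⟨δ, hδ, fun y hy => ?_⟩
  set w := y - x with hw
  have hwδ : ‖w‖ < δ := by rwa [hw, ← dist_eq_norm]
  have hVd : Differentiable ℝ V := hV.differentiable (by norm_num)
  have hder : ∀ t : ℝ, HasDerivAt (fun s : ℝ => V (x + s • w)) (⟪gradient V (x + t • w), w⟫) t := by
    intro t
    have h1 : HasDerivAt (fun s : ℝ => x + s • w) w t := by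
      simpa using ((hasDerivAt_id t).smul_const w).const_add x
    have h2 := (hVd (x + t • w)).hasGradientAt.hasFDerivAt
    have h3 := h2.comp_hasDerivAt t h1
    have h4 : (InnerProductSpace.toDual ℝ (Euc d) (gradient V (x + t • w))) w = ⟪gradient V (x + t • w), w⟫ := by
      rw [InnerProductSpace.toDual_apply_apply]
    rw [← h4]
    exact h3
  have hanti : AntitoneOn (fun s : ℝ => V (x + s • w)) (Icc 0 1) := by
    apply antitoneOn_of_deriv_nonpos (convex_Icc 0 1)
    · exact fun t _ => (hder t).continuousAt.continuousWithinAt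
    · exact fun t _ => (hder t).differentiableAt.differentiableWithinAt
    · intro t ht
      rw [interior_Icc] at ht
      rw [(hder t).deriv]
      have hlt : dist (x + t • w) x < δ := by
        rw [dist_eq_norm, add_sub_cancel_left, norm_smul, Real.norm_of_nonneg ht.1.le]
        nlinarith [ht.1, ht.2, norm_nonneg w]
      have hb := hball hlt
      rw [hg, sub_zero, add_sub_cancel_left] at hb
      have h4 := real_inner_le_norm
        (gradient V (x + t • w) - fderiv ℝ (gradient V) x (t • w)) (t • w)
      have h5 := hc (t • w)
      unfold hessQ at h5
      rw [inner_sub_left] at h4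
      have h6 := mul_le_mul_of_nonneg_right hb (norm_nonneg (t • w))
      have h7 : t * ⟪gradient V (x + t • w), w⟫ ≤ 0 := by
        rw [← real_inner_smul_right]; nlinarith
      by_contra hcon
      push Not at hcon
      exact absurd (mul_pos ht.1 hcon) (not_lt.mpr h7)
  have := hanti (left_mem_Icc.mpr zero_le_one) (right_mem_Icc.mpr zero_le_one) zero_le_one
  simpa [hw] using this

/-- away from the neighborhoods of the local maxima and of the optimal
set, the gradient norm is uniformly bounded below. -/
theorem gradient_lower_bound_outside
    {d : ℕ} (V : Euc d → ℝ) (hV : ContDiff ℝ 2 V)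
    (ν : ℝ) (𝒩 : Set (Euc d) → Set (Euc d))
    (h1 : Assumption1 V ν 𝒩) (h2 : Assumption2 V 𝒩)
    (R₀ ν_eb C_g : ℝ) (h3 : Assumption3 V R₀ ν_eb C_g)
    (R₁ μm : ℝ) (hR₁ : 0 < R₁) (hμm : 0 < μm)
    (hhess : ∀ x ∈ maxNbhd V R₁, ∀ v : Euc d, hessQ V x v ≤ -μm * ‖v‖ ^ 2) :
    ∃ g₀ > (0 : ℝ), ∀ x : Euc d, x ∉ maxNbhd V R₁ ∪ NSet V 𝒩 → g₀ ≤ ‖gradient V x‖ := by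
  have hgc : Continuous (gradient V) := (aux_contgrad V hV).continuous
  obtain ⟨hR₀, hν, _, hgrow, hcoer, hS⟩ := h3
  have hSne : (localMinSet V).Nonempty := by
    obtain ⟨z, hz⟩ := hV.continuous.exists_forall_le hcoer
    exact ⟨z, Filter.Eventually.of_forall hz⟩
  have hNo : IsOpen (NSet V 𝒩) :=
    isOpen_biUnion fun x hx => (h1.2 x hx).1
  set C : Set (Euc d) := {x | x ∉ NSet V 𝒩 ∧ ((localMaxSet V).Nonempty →
    R₁ ≤ infDist x (localMaxSet V))} with hC
  have hCc : IsClosed C := by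
    refine hNo.isClosed_compl.inter ?_
    change IsClosed {x : Euc d | (localMaxSet V).Nonempty → R₁ ≤ infDist x (localMaxSet V)}
    by_cases h : (localMaxSet V).Nonempty
    · have : IsClosed {x : Euc d | R₁ ≤ infDist x (localMaxSet V)} :=
        isClosed_le continuous_const (continuous_infDist_pt _)
      simpa [h] using this
    · simp [h]
  have hsub : ∀ x, x ∉ maxNbhd V R₁ ∪ NSet V 𝒩 → x ∈ C := by
    intro x hx
    simp only [mem_union, not_or] at hx
    refine ⟨hx.2, fun hne => ?_⟩
    by_contra hlt
    exact hx.1 ⟨hne, (not_le.mp hlt).le⟩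
  have hpos : ∀ x ∈ C, 0 < ‖gradient V x‖ := by
    intro x hx
    rw [norm_pos_iff]
    intro h0
    have hm : x ∈ localMaxSet V := aux_localMax V hV x h0 (h2 x hx.1 h0)
    have := hx.2 ⟨x, hm⟩
    rw [infDist_zero_of_mem hm] at this
    linarith
  have hK : IsCompact (C ∩ closedBall 0 (R₀ + 1)) :=
    (isCompact_closedBall _ _).inter_left hCc
  have hin : ∃ a > (0 : ℝ), ∀ x ∈ C ∩ closedBall 0 (R₀ + 1), a ≤ ‖gradient V x‖ := by
    by_cases hne : (C ∩ closedBall 0 (R₀ + 1)).Nonempty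
    · obtain ⟨u, hu, hmin⟩ := hK.exists_isMinOn hne hgc.norm.continuousOn
      exact ⟨_, hpos u hu.1, fun x hx => hmin hx⟩
    · exact ⟨1, one_pos, fun x hx => absurd ⟨x, hx⟩ hne⟩
  obtain ⟨a, ha, hin⟩ := hin
  refine ⟨min a ν_eb, lt_min ha hν, fun x hx => ?_⟩
  by_cases hxb : x ∈ closedBall (0 : Euc d) (R₀ + 1)
  · exact (min_le_left _ _).trans (hin x ⟨hsub x hx, hxb⟩)
  · have hxn : R₀ + 1 < ‖x‖ := by simpa using hxb
    refine (min_le_right _ _).trans (le_trans ?_ (hgrow x (by linarith)).1)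
    have : 1 ≤ infDist x (localMinSet V) := by
      rw [le_infDist hSne]
      intro y hy
      have hyn : ‖y‖ ≤ R₀ := by simpa using hS hy
      have := norm_sub_norm_le x y
      rw [dist_eq_norm]
      linarith
    nlinarith
end
end

section
/- Let V : ℝ^d → ℝ satisfy Assumptions 1–3. Then the set of all local minima of V has at most finitely many connected components. -/
open MeasureTheory Real Filter Metric Set
open scoped RealInnerProductSpace ENNReal Topology

noncomputable section

variable {d : ℕ}

lemma flow_aux {X : Type*} [MetricSpace X] [CompleteSpace X] (x : X) (T : X → X) (h : X → ℝ)
    (r q C : ℝ) (hr : 0 < r) (q0 : 0 ≤ q) (q1 : q < 1) (C0 : 0 ≤ C)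
    (hT : Continuous T) (hh : Continuous h) (h0 : ∀ y, 0 ≤ h y) (hx : h x = 0)
    (H1 : ∀ y ∈ ball x r, h (T y) ≤ q * h y)
    (H2 : ∀ y ∈ ball x r, dist y (T y) ≤ C * h y) :
    ∃ δ > 0, ∃ G : X → X, ContinuousOn G (ball x δ) ∧
      ∀ y ∈ ball x δ, G y ∈ ball x r ∧ h (G y) = 0 ∧ (T y = y → G y = y) := by
  have hq : 0 < 1 - q := by linarith
  have e1 : ∀ᶠ y in 𝓝 x, C * h y / (1 - q) < r / 4 := by
    have : Tendsto (fun y => C * h y / (1 - q)) (𝓝 x) (𝓝 (C * h x / (1 - q))) :=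
      ((continuous_const.mul hh).div_const _).tendsto x
    rw [hx] at this
    exact this.eventually_lt_const (by simpa using by linarith)
  have e2 : ∀ᶠ y in 𝓝 x, dist y x < r / 4 := ball_mem_nhds x (by linarith)
  obtain ⟨δ, hδ, hb⟩ := Metric.eventually_nhds_iff_ball.1 (e1.and e2)
  have key : ∀ y ∈ ball x δ, ∀ n : ℕ, dist y (T^[n] y) ≤ C * h y / (1 - q) * (1 - q ^ n) ∧
      h (T^[n] y) ≤ q ^ n * h y ∧ dist (T^[n] y) x < r / 2 := by
    intro y hy n
    obtain ⟨b1, b2⟩ := hb y hy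
    have hA : 0 ≤ C * h y / (1 - q) := by have := h0 y; positivity
    have fin : ∀ n : ℕ, dist y (T^[n] y) ≤ C * h y / (1 - q) * (1 - q ^ n) →
        dist (T^[n] y) x < r / 2 := by
      intro n hn
      have : 0 ≤ q ^ n := by positivity
      have t := dist_triangle (T^[n] y) y x
      rw [dist_comm (T^[n] y) y] at t
      nlinarith
    induction n with
    | zero => simp; linarith
    | succ n ih =>
      obtain ⟨i1, i2, i3⟩ := ih
      have hm : T^[n] y ∈ ball x r := by rw [mem_ball]; linarith
      have a1 := H1 _ hm
      have a2 := H2 _ hm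
      have s1 : dist y (T^[n+1] y) ≤ C * h y / (1 - q) * (1 - q ^ (n+1)) := by
        rw [Function.iterate_succ_apply']
        have t := dist_triangle y (T^[n] y) (T (T^[n] y))
        have u : C * h (T^[n] y) ≤ C * (q ^ n * h y) := by gcongr
        have w : C * h y / (1 - q) * (1 - q ^ (n+1)) =
          C * h y / (1 - q) * (1 - q ^ n) + C * (q ^ n * h y) := by
          field_simp; ring
        linarith
      refine ⟨s1, ?_, fin _ s1⟩
      rw [Function.iterate_succ_apply']
      calc _ ≤ q * h (T^[n] y) := a1
        _ ≤ q * (q ^ n * h y) := by gcongr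
        _ = _ := by ring
  have step : ∀ y ∈ ball x δ, ∀ n : ℕ, dist (T^[n] y) (T^[n+1] y) ≤ (C * h y) * q ^ n := by
    intro y hy n
    obtain ⟨_, i2, i3⟩ := key y hy n
    rw [Function.iterate_succ_apply']
    calc _ ≤ C * h (T^[n] y) := H2 _ (by rw [mem_ball]; linarith)
      _ ≤ C * (q ^ n * h y) := by gcongr
      _ = _ := by ring
  have lim : ∀ y, ∃ z, y ∈ ball x δ → Tendsto (fun n => T^[n] y) atTop (𝓝 z) := by
    intro y
    by_cases hy : y ∈ ball x δ
    · obtain ⟨z, hz⟩ := cauchySeq_tendsto_of_complete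
        (cauchySeq_of_le_geometric q (C * h y) q1 (step y hy))
      exact ⟨z, fun _ => hz⟩
    · exact ⟨y, fun h => absurd h hy⟩
  choose G hG using lim
  refine ⟨δ, hδ, G, ?_, ?_⟩
  · have hu : TendstoUniformlyOn (fun n y => T^[n] y) G atTop (ball x δ) := by
      rw [Metric.tendstoUniformlyOn_iff]
      intro ε hε
      have : Tendsto (fun n : ℕ => r / 4 * q ^ n) atTop (𝓝 (r / 4 * 0)) :=
        (tendsto_pow_atTop_nhds_zero_of_lt_one q0 q1).const_mul _
      filter_upwards [this.eventually_lt_const (by simpa using hε)] with n hn y hy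
      have := dist_le_of_le_geometric_of_tendsto q (C * h y) q1 (step y hy) (hG y hy) n
      rw [dist_comm]
      refine lt_of_le_of_lt this (lt_of_le_of_lt ?_ hn)
      have b := (hb y hy).1
      have p : 0 ≤ q ^ n := by positivity
      calc _ = C * h y / (1 - q) * q ^ n := by ring
        _ ≤ _ := by gcongr
    exact hu.continuousOn (Frequently.of_forall fun n => (hT.iterate n).continuousOn)
  · intro y hy
    refine ⟨?_, ?_, ?_⟩
    · have : dist (G y) x ≤ r / 2 :=
        le_of_tendsto ((hG y hy).dist tendsto_const_nhds)
          (Eventually.of_forall fun n => (key y hy n).2.2.le)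
      rw [mem_ball]; linarith
    · have a : Tendsto (fun n => h (T^[n] y)) atTop (𝓝 (h (G y))) :=
        (hh.tendsto _).comp (hG y hy)
      have b : Tendsto (fun n : ℕ => q ^ n * h y) atTop (𝓝 (0 * h y)) :=
        (tendsto_pow_atTop_nhds_zero_of_lt_one q0 q1).mul_const _
      rw [zero_mul] at b
      exact le_antisymm (le_of_tendsto_of_tendsto' a b fun n => (key y hy n).2.1) (h0 _)
    · intro hf
      have : (fun n => T^[n] y) = fun _ => y := by
        funext n; exact Function.iterate_fixed hf n
      have a := hG y hy
      rw [this] at a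
      exact (tendsto_nhds_unique a tendsto_const_nhds)

lemma gradient_contDiff (V : Euc d → ℝ) (hV : ContDiff ℝ 2 V) : ContDiff ℝ 1 (gradient V) :=
  (InnerProductSpace.toDual ℝ (Euc d)).symm.contDiff.comp
    (hV.fderiv_right (m := 1) (by norm_num))

lemma gradient_zero_of_localMin (V : Euc d → ℝ) {x : Euc d} (hx : x ∈ localMinSet V) :
    gradient V x = 0 := by
  have : IsLocalMin V x := hx
  simp [gradient, this.fderiv_eq_zero]

lemma descent (V : Euc d → ℝ) (hV : ContDiff ℝ 2 V) (s : Set (Euc d)) (hs : Convex ℝ s)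
    (L : ℝ) (hL : 0 < L) (hlip : ∀ y ∈ s, ∀ z ∈ s, ‖gradient V y - gradient V z‖ ≤ L * ‖y - z‖)
    (y : Euc d) (hy : y ∈ s) (hy' : y - (1 / (2 * L)) • gradient V y ∈ s) :
    V (y - (1 / (2 * L)) • gradient V y) ≤ V y - 1 / (4 * L) * ‖gradient V y‖ ^ 2 := by
  set g := gradient V y with hg
  set y' := y - (1 / (2 * L)) • g with hy'def
  have hd : Differentiable ℝ V := hV.differentiable (by norm_num)
  have hn : ‖y' - y‖ = 1 / (2 * L) * ‖g‖ := by
    rw [hy'def, sub_sub_cancel_left, norm_neg, norm_smul, Real.norm_of_nonneg (by positivity)]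
  have hseg : segment ℝ y y' ⊆ s := hs.segment_subset hy hy'
  have b := Convex.norm_image_sub_le_of_norm_hasFDerivWithin_le' (f := V) (f' := fderiv ℝ V)
    (φ := fderiv ℝ V y) (C := L * ‖y' - y‖) (s := segment ℝ y y')
    (fun z _ => (hd z).hasFDerivAt.hasFDerivWithinAt)
    (fun z hz => by
      have e : ‖fderiv ℝ V z - fderiv ℝ V y‖ = ‖gradient V z - gradient V y‖ := by
        rw [gradient, gradient, ← map_sub, LinearIsometryEquiv.norm_map]
      rw [e]
      refine (hlip z (hseg hz) y hy).trans ?_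
      gcongr
      exact norm_sub_le_of_mem_segment hz)
    (convex_segment _ _) (left_mem_segment _ _ _) (right_mem_segment _ _ _)
  have c : fderiv ℝ V y (y' - y) = - (1 / (2 * L) * ‖g‖ ^ 2) := by
    have : fderiv ℝ V y g = ‖g‖ ^ 2 := by
      rw [← real_inner_self_eq_norm_sq]
      conv_rhs => rw [hg, gradient, InnerProductSpace.toDual_symm_apply]
      rfl
    rw [hy'def, sub_sub_cancel_left, map_neg, map_smul, this, smul_eq_mul]
  rw [c, hn] at b
  have b' := (abs_le.1 b).2
  have : L * (1 / (2 * L) * ‖g‖) * (1 / (2 * L) * ‖g‖) = 1 / (4 * L) * ‖g‖ ^ 2 := by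
    field_simp; ring
  have t : 1 / (2 * L) * ‖g‖ ^ 2 = 2 * (1 / (4 * L) * ‖g‖ ^ 2) := by field_simp; ring
  linarith

lemma local_conn (V : Euc d → ℝ) (hV : ContDiff ℝ 2 V) (ν : ℝ) (hν : 0 < ν)
    (N : Set (Euc d)) (hN : IsOpen N) (hb : BddBelow (V '' N))
    (hPL : ∀ y ∈ N, ν * (V y - sInf (V '' N)) ≤ ‖gradient V y‖ ^ 2)
    (x : Euc d) (hx : x ∈ localMinSet V) (hxN : x ∈ N) :
    ∃ δ > 0, ∀ y ∈ ball x δ, y ∈ localMinSet V → y ∈ connectedComponentIn (localMinSet V) x := by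
  have hg0 := gradient_zero_of_localMin V hx
  have hVx : V x = sInf (V '' N) := by
    apply le_antisymm
    · have := hPL x hxN
      rw [hg0] at this
      simp at this
      nlinarith
    · exact csInf_le hb ⟨x, hxN, rfl⟩
  have hmin : ∀ y ∈ N, V x ≤ V y := fun y hy => hVx ▸ csInf_le hb ⟨y, hy, rfl⟩
  rw [← hVx] at hPL
  obtain ⟨K, t, ht, hK⟩ := (gradient_contDiff V hV).contDiffAt (x := x).exists_lipschitzOnWith
  obtain ⟨ρ, hρ, hρs⟩ := Metric.mem_nhds_iff.1 (Filter.inter_mem ht (hN.mem_nhds hxN))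
  set L : ℝ := K + 1 with hLd
  have hL : 0 < L := by positivity
  have hlip : ∀ y ∈ ball x ρ, ∀ z ∈ ball x ρ, ‖gradient V y - gradient V z‖ ≤ L * ‖y - z‖ := by
    intro y hy z hz
    have := hK.dist_le_mul y (hρs hy).1 z (hρs hz).1
    rw [dist_eq_norm, dist_eq_norm] at this
    have : 0 ≤ ‖y - z‖ := norm_nonneg _
    nlinarith
  set T : Euc d → Euc d := fun y => y - (1 / (2 * L)) • gradient V y with hTd
  have hgc : Continuous (gradient V) := (gradient_contDiff V hV).continuous
  have hTc : Continuous T := by fun_prop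
  have hTm : ∀ y ∈ ball x (ρ / 2), T y ∈ ball x ρ := by
    intro y hy
    have hy' : y ∈ ball x ρ := ball_subset_ball (by linarith) hy
    have a := hlip y hy' x (mem_ball_self hρ)
    rw [hg0, sub_zero] at a
    rw [mem_ball, dist_eq_norm] at hy ⊢
    have e : T y - x = (y - x) - (1 / (2 * L)) • gradient V y := by simp only [hTd]; abel
    have b : ‖(1 / (2 * L)) • gradient V y‖ ≤ ‖y - x‖ / 2 := by
      rw [norm_smul, Real.norm_of_nonneg (by positivity)]
      calc _ ≤ 1 / (2 * L) * (L * ‖y - x‖) := by gcongr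
        _ = _ := by field_simp
    rw [e]
    have := norm_sub_le (y - x) ((1 / (2 * L)) • gradient V y)
    linarith
  have hdes : ∀ y ∈ ball x (ρ / 2), V (T y) ≤ V y - 1 / (4 * L) * ‖gradient V y‖ ^ 2 := by
    intro y hy
    exact descent V hV (ball x ρ) (convex_ball _ _) L hL hlip y
      (ball_subset_ball (by linarith) hy) (hTm y hy)
  have hNb : ∀ y ∈ ball x (ρ / 2), y ∈ N := fun y hy =>
    (hρs (ball_subset_ball (by linarith) hy)).2
  set c : ℝ := 1 - 1 / (4 * L) * ν with hc
  have hcl : c < 1 := by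
    have : 0 < 1 / (4 * L) * ν := by positivity
    linarith
  obtain ⟨δ, hδ, G, hGc, hG⟩ := flow_aux x T (fun y => √(V y - V x)) (ρ / 2) (√c)
    (1 / (2 * L) * √(4 * L)) (by linarith) (Real.sqrt_nonneg _)
    (by rw [Real.sqrt_lt' one_pos]; simpa using hcl) (by positivity) hTc
    ((hV.continuous.sub continuous_const).sqrt) (fun y => Real.sqrt_nonneg _) (by simp)
    (by
      intro y hy
      have p := hPL y (hNb y hy)
      have f0 := hmin y (hNb y hy)
      rw [← Real.sqrt_mul' _ (by linarith)]
      apply Real.sqrt_le_sqrt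
      have d := hdes y hy
      have : 1 / (4 * L) * (ν * (V y - V x)) ≤ 1 / (4 * L) * ‖gradient V y‖ ^ 2 := by gcongr
      rw [hc]
      linarith)
    (by
      intro y hy
      have f0 := hmin _ (hρs (hTm y hy)).2
      have d := hdes y hy
      have e : dist y (T y) = 1 / (2 * L) * ‖gradient V y‖ := by
        rw [dist_eq_norm]
        simp only [hTd]
        rw [sub_sub_cancel, norm_smul, Real.norm_of_nonneg (by positivity)]
      rw [e, mul_assoc]
      gcongr
      rw [← Real.sqrt_mul (by positivity)]
      apply Real.le_sqrt_of_sq_le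
      have : 1 / (4 * L) * ‖gradient V y‖ ^ 2 ≤ V y - V x := by linarith
      calc _ = 4 * L * (1 / (4 * L) * ‖gradient V y‖ ^ 2) := by field_simp
        _ ≤ _ := by gcongr)
  have hfix : ∀ z ∈ localMinSet V, T z = z := by
    intro z hz
    simp [hTd, gradient_zero_of_localMin V hz]
  have hsub : G '' ball x δ ⊆ localMinSet V := by
    rintro _ ⟨y, hy, rfl⟩
    obtain ⟨a1, a2, -⟩ := hG y hy
    have hGN := hNb _ a1
    have : V (G y) ≤ V x := by
      have := Real.sqrt_eq_zero'.1 a2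
      linarith
    show IsLocalMin V (G y)
    filter_upwards [hN.mem_nhds hGN] with z hz
    exact this.trans (hmin z hz)
  refine ⟨δ, hδ, fun y hy hyS => ?_⟩
  have hconn : IsPreconnected (G '' ball x δ) :=
    (convex_ball x δ).isPreconnected.image G hGc
  have hxm := mem_ball_self (x := x) hδ
  exact hconn.subset_connectedComponentIn ⟨x, hxm, (hG x hxm).2.2 (hfix x hx)⟩ hsub
    ⟨y, hy, (hG y hy).2.2 (hfix y hyS)⟩

lemma hessQ_nonneg (V : Euc d → ℝ) (hV : ContDiff ℝ 2 V) (z : Euc d) (hz : z ∈ localMinSet V)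
    (v : Euc d) : 0 ≤ hessQ V z v := by
  by_contra! hneg
  have hd : Differentiable ℝ V := hV.differentiable (by norm_num)
  have hgd : Differentiable ℝ (gradient V) := (gradient_contDiff V hV).differentiable (by norm_num)
  have hl : ∀ t : ℝ, HasDerivAt (fun t : ℝ => z + t • v) v t := by
    intro t
    simpa using ((hasDerivAt_id t).smul_const v).const_add z
  set φ : ℝ → ℝ := fun t => V (z + t • v) with hφ
  have h1 : ∀ t, HasDerivAt φ ⟪gradient V (z + t • v), v⟫ t := by
    intro t
    have := (hd (z + t • v)).hasFDerivAt.comp_hasDerivAt t (hl t)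
    rw [gradient, InnerProductSpace.toDual_symm_apply]
    exact this
  have hdφ : deriv φ = fun t => ⟪gradient V (z + t • v), v⟫ := funext fun t => (h1 t).deriv
  have h2 : HasDerivAt (deriv φ) (hessQ V z v) 0 := by
    rw [hdφ]
    have a := (hgd (z + (0:ℝ) • v)).hasFDerivAt.comp_hasDerivAt (0:ℝ) (hl 0)
    have b := a.inner ℝ (hasDerivAt_const (0:ℝ) v)
    simpa [hessQ] using b
  have hmin : IsLocalMin φ 0 := by
    have : IsLocalMin V (z + (0:ℝ) • v) := by
      rw [zero_smul, add_zero]; exact hz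
    exact this.comp_continuous (g := fun t : ℝ => z + t • v) (hl 0).continuousAt
  have hmax : IsLocalMax φ 0 := by
    apply isLocalMax_of_deriv_deriv_neg (by rw [h2.deriv]; exact hneg) hmin.deriv_eq_zero
      (h1 0).continuousAt
  have hc : φ =ᶠ[𝓝 0] fun _ => φ 0 := by
    filter_upwards [hmin, hmax] with t a b
    exact le_antisymm b a
  have h3 := hc.deriv.deriv_eq
  rw [h2.deriv] at h3
  simp at h3
  linarith

/-- the set of local minima of `V` has at most finitely many connected
components. -/
theorem localMinSet_finitely_many_components
    {d : ℕ} (V : Euc d → ℝ) (hV : ContDiff ℝ 2 V)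
    (ν : ℝ) (𝒩 : Set (Euc d) → Set (Euc d))
    (h1 : Assumption1 V ν 𝒩) (h2 : Assumption2 V 𝒩)
    (R₀ ν_eb C_g : ℝ) (h3 : Assumption3 V R₀ ν_eb C_g) :
    {C : Set (Euc d) | ∃ x ∈ localMinSet V,
        C = connectedComponentIn (localMinSet V) x}.Finite := by
  classical
  obtain ⟨hν, hA⟩ := h1
  obtain ⟨-, -, -, -, hcoer, hball⟩ := h3
  rcases subsingleton_or_nontrivial (Euc d) with hsub | hnt
  · exact Set.toFinite _
  obtain ⟨m, hm⟩ := hV.continuous.exists_forall_le hcoer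
  have hbdd : ∀ N : Set (Euc d), BddBelow (V '' N) := by
    rintro N
    exact ⟨V m, by rintro _ ⟨y, -, rfl⟩; exact hm y⟩
  have hgc := gradient_contDiff V hV
  have hclosed : IsClosed (localMinSet V) := by
    refine isClosed_of_closure_subset fun x hx => ?_
    have hg : gradient V x = 0 := by
      have : closure (localMinSet V) ⊆ {y | gradient V y = 0} :=
        closure_minimal (fun y hy => gradient_zero_of_localMin V hy)
          (isClosed_eq hgc.continuous continuous_const)
      exact this hx
    by_cases hxN : x ∈ NSet V 𝒩
    · simp only [NSet, mem_iUnion] at hxN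
      obtain ⟨y, hy, hxN⟩ := hxN
      obtain ⟨ho, -, -, hPL⟩ := hA y hy
      have a := hPL x hxN
      rw [hg] at a
      simp at a
      show IsLocalMin V x
      filter_upwards [ho.mem_nhds hxN] with z hz
      have b := csInf_le (hbdd _) (mem_image_of_mem V hz)
      nlinarith
    · exfalso
      obtain ⟨v, hv⟩ := exists_ne (0 : Euc d)
      have a := h2 x hxN hg v hv
      have hc : Continuous fun y => hessQ V y v := by
        unfold hessQ
        exact ((hgc.continuous_fderiv (by norm_num)).clm_apply continuous_const).inner
          continuous_const
      have : closure (localMinSet V) ⊆ {y | 0 ≤ hessQ V y v} :=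
        closure_minimal (fun y hy => hessQ_nonneg V hV y hy v)
          (isClosed_le continuous_const hc)
      exact absurd (this hx) (not_le.2 a)
  have hcomp : IsCompact (localMinSet V) :=
    (isCompact_closedBall (0 : Euc d) R₀).of_isClosed_subset hclosed hball
  have hloc : ∀ x ∈ localMinSet V, ∃ δ > 0, ∀ y ∈ ball x δ, y ∈ localMinSet V →
      y ∈ connectedComponentIn (localMinSet V) x := by
    intro x hx
    obtain ⟨ho, hs, -, hPL⟩ := hA x hx
    exact local_conn V hV ν hν _ ho (hbdd _) hPL x hx (hs (mem_connectedComponentIn hx))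
  choose! δ hδ hδc using hloc
  obtain ⟨t, ht, hcov⟩ := hcomp.elim_nhds_subcover (fun x => ball x (δ x))
    (fun x hx => ball_mem_nhds x (hδ x hx))
  refine (t.finite_toSet.image (fun x => connectedComponentIn (localMinSet V) x)).subset ?_
  rintro C ⟨x, hx, rfl⟩
  have := hcov hx
  simp only [mem_iUnion] at this
  obtain ⟨y, hy, hxy⟩ := this
  exact ⟨y, hy, connectedComponentIn_eq (hδc y (ht y hy) x hxy hx)⟩
end
end

section
/- Let Γ ⊆ ℝ^k be open, let M : Γ → ℝ^d be a C² map whose differential has rank k everywhere (so the k×k Gram matrix g(u) with entries g_{ij}(u) = ∂M/∂u^i · ∂M/∂u^j is invertible), and let N_{k+1}, …, N_d : Γ → ℝ^d be C¹ maps with ∂M/∂u^i(u) · N_l(u) = 0 and N_i(u) · N_j(u) = δ_{ij} for all u ∈ Γ and all admissible indices. Define G_{ij}(l)(u) = ∂M/∂u^i(u) · ∂N_l/∂u^j(u), the matrix G̃(l)(u) = g(u)^{-1} G(l)(u), and the map y : Γ × ℝ^{d−k} → ℝ^d, y(u,r) = M(u) + Σ_{l=k+1}^d r^l N_l(u). Then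 the Jacobian determinant of y satisfies |det Dy(u,r)| = |det( I_k + Σ_{l=k+1}^d r^l G̃(l)(u) )| · √(det g(u)) for every (u,r) ∈ Γ × ℝ^{d−k}. -/
open Set Metric MeasureTheory
open scoped RealInnerProductSpace

noncomputable section

variable {k m : ℕ}

/-- The partial derivative `∂M/∂uⁱ` of a map between Euclidean spaces. -/
def pd {n n' : ℕ} (M : Euc n → Euc n') (u : Euc n) (i : Fin n) : Euc n' :=
  fderiv ℝ M u (EuclideanSpace.basisFun (Fin n) ℝ i)

/-- The Gram matrix (first fundamental form) `g_{ij} = ∂M/∂uⁱ · ∂M/∂uʲ`. -/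
def gram (M : Euc k → Euc (k + m)) (u : Euc k) : Matrix (Fin k) (Fin k) ℝ :=
  Matrix.of fun i j => ⟪pd M u i, pd M u j⟫

/-- The matrix `G(l)` with entries `G_{ij}(l) = ∂M/∂uⁱ · ∂N_l/∂uʲ`. -/
def secondG (M : Euc k → Euc (k + m)) (N : Fin m → Euc k → Euc (k + m)) (l : Fin m)
    (u : Euc k) : Matrix (Fin k) (Fin k) ℝ :=
  Matrix.of fun i j => ⟪pd M u i, pd (N l) u j⟫

/-- The matrix `G̃(l) = g⁻¹ G(l)`. -/
def tildeG (M : Euc k → Euc (k + m)) (N : Fin m → Euc k → Euc (k + m)) (l : Fin m)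
    (u : Euc k) : Matrix (Fin k) (Fin k) ℝ :=
  (gram M u)⁻¹ * secondG M N l u

/-- The tubular-coordinate map `y(u, r) = M(u) + Σ_l r^l N_l(u)`. -/
def tubularMap (M : Euc k → Euc (k + m)) (N : Fin m → Euc k → Euc (k + m)) :
    Euc k × Euc m → Euc (k + m) :=
  fun p => M p.1 + ∑ l, p.2 l • N l p.1

/-- The `b`-th standard basis vector of `ℝ^k × ℝ^m`, with the first `k` indices in the
`u`-directions and the last `m` indices in the `r`-directions. -/
def prodBasisVec (k m : ℕ) (b : Fin (k + m)) : Euc k × Euc m :=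
  Sum.elim (fun i => (EuclideanSpace.basisFun (Fin k) ℝ i, 0))
    (fun l => (0, EuclideanSpace.basisFun (Fin m) ℝ l)) (finSumFinEquiv.symm b)

/-- The `(k+m) × (k+m)` Jacobian matrix of the tubular-coordinate map `y` at `(u, r)`,
in standard bases. -/
def tubularJacobian (M : Euc k → Euc (k + m)) (N : Fin m → Euc k → Euc (k + m))
    (u : Euc k) (r : Euc m) : Matrix (Fin (k + m)) (Fin (k + m)) ℝ :=
  Matrix.of fun a b => fderiv ℝ (tubularMap M N) (u, r) (prodBasisVec k m b) a

def tubMat {k m : ℕ} (v : Fin k ⊕ Fin m → Euc (k + m)) :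
    Matrix (Fin (k + m)) (Fin (k + m)) ℝ :=
  Matrix.of fun a b => v (finSumFinEquiv.symm b) a

lemma tubMat_det {k m : ℕ} (v w : Fin k ⊕ Fin m → Euc (k + m)) :
    (tubMat v).det * (tubMat w).det
      = (Matrix.of fun i j : Fin k ⊕ Fin m => (⟪v i, w j⟫ : ℝ)).det := by
  rw [← Matrix.det_transpose (tubMat v), ← Matrix.det_mul,
    ← Matrix.det_submatrix_equiv_self (finSumFinEquiv (m := k) (n := m))]
  congr 1
  ext i j
  simp [tubMat, Matrix.mul_apply, PiLp.inner_apply, mul_comm]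

lemma tubFderiv {k m : ℕ} (M : Euc k → Euc (k + m)) (N : Fin m → Euc k → Euc (k + m))
    (u : Euc k) (r : Euc m) (hM : DifferentiableAt ℝ M u)
    (hN : ∀ l, DifferentiableAt ℝ (N l) u) (x : Euc k) (s : Euc m) :
    fderiv ℝ (tubularMap M N) (u, r) (x, s)
      = fderiv ℝ M u x + ∑ l, (r l • fderiv ℝ (N l) u x + s l • N l u) := by
  have h1 : HasFDerivAt (fun p : Euc k × Euc m => M p.1)
      ((fderiv ℝ M u).comp (ContinuousLinearMap.fst ℝ (Euc k) (Euc m))) (u, r) :=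
    HasFDerivAt.comp (u, r) (g := M) hM.hasFDerivAt hasFDerivAt_fst
  have h2 : ∀ l, HasFDerivAt (fun p : Euc k × Euc m => N l p.1)
      ((fderiv ℝ (N l) u).comp (ContinuousLinearMap.fst ℝ (Euc k) (Euc m))) (u, r) :=
    fun l => HasFDerivAt.comp (u, r) (g := N l) (hN l).hasFDerivAt hasFDerivAt_fst
  have h3 : ∀ l : Fin m, HasFDerivAt (fun p : Euc k × Euc m => p.2 l)
      ((EuclideanSpace.proj (𝕜 := ℝ) l).comp (ContinuousLinearMap.snd ℝ (Euc k) (Euc m))) (u, r) :=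
    fun l => ((EuclideanSpace.proj (𝕜 := ℝ) l).comp
      (ContinuousLinearMap.snd ℝ (Euc k) (Euc m))).hasFDerivAt
  have h := h1.add (HasFDerivAt.fun_sum (u := Finset.univ) fun l _ => (h3 l).smul (h2 l))
  have h' : HasFDerivAt (tubularMap M N) _ (u, r) := h
  rw [h'.fderiv]
  simp

/-- Jacobian determinant of tubular coordinates.
`|det Dy(u,r)| = |det(I + Σ_l r^l G̃(l)(u))| · √(det g(u))`. -/
theorem tubular_jacobian_det
    (k m : ℕ) (Γ : Set (Euc k)) (M : Euc k → Euc (k + m))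
    (N : Fin m → Euc k → Euc (k + m))
    (hΓ : IsOpen Γ) (hM : ContDiffOn ℝ 2 M Γ)
    (hrank : ∀ u ∈ Γ, LinearIndependent ℝ (fun i : Fin k => pd M u i))
    (hN : ∀ l, ContDiffOn ℝ 1 (N l) Γ)
    (horth : ∀ u ∈ Γ, ∀ (i : Fin k) (l : Fin m), ⟪pd M u i, N l u⟫ = 0)
    (honb : ∀ u ∈ Γ, ∀ l l' : Fin m, ⟪N l u, N l' u⟫ = if l = l' then 1 else 0) :
    ∀ u ∈ Γ, ∀ r : Euc m,
      |(tubularJacobian M N u r).det|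
        = |(1 + ∑ l, r l • tildeG M N l u).det| * Real.sqrt (gram M u).det := by
  intro u hu r
  have hMd : DifferentiableAt ℝ M u :=
    (hM.contDiffAt (hΓ.mem_nhds hu)).differentiableAt (by norm_num)
  have hNd : ∀ l, DifferentiableAt ℝ (N l) u := fun l =>
    ((hN l).contDiffAt (hΓ.mem_nhds hu)).differentiableAt (by norm_num)
  have hNo : ∀ (l : Fin m) (i : Fin k), ⟪N l u, pd M u i⟫ = 0 := fun l i => by
    rw [real_inner_comm]; exact horth u hu i l
  set v : Fin k ⊕ Fin m → Euc (k + m) := Sum.elim (fun i => pd M u i) (fun l => N l u) with hv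
  set w : Fin k ⊕ Fin m → Euc (k + m) :=
    Sum.elim (fun i => pd M u i + ∑ l, r l • pd (N l) u i) (fun l => N l u) with hw
  have hJ : tubularJacobian M N u r = tubMat w := by
    ext a b
    obtain ⟨c, rfl⟩ := finSumFinEquiv.surjective b
    simp only [tubularJacobian, tubMat, prodBasisVec, Matrix.of_apply, Equiv.symm_apply_apply]
    rcases c with i | l
    · simp only [Sum.elim_inl, tubFderiv M N u r hMd hNd, hw]
      simp [pd]
    · simp only [Sum.elim_inr, tubFderiv M N u r hMd hNd, hw]
      simp [Pi.single_apply]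
  have hg : (gram M u).det ≠ 0 := by
    have := (Matrix.posDef_gram_of_linearIndependent (𝕜 := ℝ) (hrank u hu)).det_pos
    exact this.ne'
  have e1 : (tubMat v).det * (tubMat v).det = (gram M u).det := by
    rw [tubMat_det]
    have : (Matrix.of fun i j : Fin k ⊕ Fin m => (⟪v i, v j⟫ : ℝ))
        = Matrix.fromBlocks (gram M u) 0 0 1 := by
      ext i j
      rcases i with i | i <;> rcases j with j | j <;>
        simp [hv, gram, horth u hu, hNo, honb u hu, Matrix.one_apply]
    rw [this, Matrix.det_fromBlocks_zero₁₂, Matrix.det_one, mul_one]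
  have e2 : (tubMat v).det * (tubMat w).det
      = (gram M u).det * (1 + ∑ l, r l • tildeG M N l u).det := by
    rw [tubMat_det, ← Matrix.det_mul]
    have : (Matrix.of fun i j : Fin k ⊕ Fin m => (⟪v i, w j⟫ : ℝ))
        = Matrix.fromBlocks (gram M u * (1 + ∑ l, r l • tildeG M N l u)) 0
          (Matrix.of fun l j => ⟪N l u, w (Sum.inl j)⟫) 1 := by
      have hm : gram M u * (1 + ∑ l, r l • tildeG M N l u)
          = gram M u + ∑ l, r l • secondG M N l u := by
        simp only [mul_add, mul_one, Finset.mul_sum, Matrix.mul_smul, tildeG]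
        simp [Matrix.mul_nonsing_inv_cancel_left _ _ (isUnit_iff_ne_zero.mpr hg)]
      rw [hm]
      ext i j
      rcases i with i | i <;> rcases j with j | j <;>
        simp [hv, hw, gram, secondG, horth u hu, honb u hu, Matrix.one_apply, inner_add_right,
          inner_sum, inner_smul_right, Matrix.sum_apply]
    rw [this, Matrix.det_fromBlocks_zero₁₂, Matrix.det_one, mul_one]
  rw [hJ, ← e1, Real.sqrt_mul_self_eq_abs]
  rw [← e1] at e2 hg
  have h0 : (tubMat v).det ≠ 0 := left_ne_zero_of_mul hg
  rw [mul_assoc] at e2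
  rw [mul_left_cancel₀ h0 e2, abs_mul, mul_comm]
end
end
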